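/- arXiv:0707.0500 — 10 statements merged into one kernel-verified Lean document; each statement's English description precedes it below -/
import Mathlib

section
/- Let P be an n×n row-stochastic matrix with a stationary probability vector π (i.e., πᵀP = πᵀ), and suppose there is a constant 0 < c < 1 such that P(i,j) ≥ (1−c)·π(j) for all states i, j. Then for every probability vector p on the n states and every integer t ≥ 0, the distribution after t steps satisfies ‖(Pᵗ)ᵀ p − π‖₁ ≤ 2cᵗ. -/
open Matrix in
lemma sum_vecMul_of_row_sum_one {ι : Type*} [Fintype ι] {P : Matrix ι ι ℝ}
    (hProw : ∀ i, ∑ j, P i j = 1) (v : ι → ℝ) :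
    ∑ j, (v ᵥ* P) j = ∑ i, v i := by
  simp only [vecMul, dotProduct]
  rw [Finset.sum_comm]
  simp [← Finset.mul_sum, hProw]

open Matrix in
/-- Under a minorization `(1 - c) * q j ≤ P i j`, a stochastic matrix contracts the `ℓ₁` norm
by the factor `c` on vectors of total mass zero. -/
lemma sum_abs_vecMul_le_of_minorization {ι : Type*} [Fintype ι] {P : Matrix ι ι ℝ} {q : ι → ℝ}
    {c : ℝ} (hProw : ∀ i, ∑ j, P i j = 1) (hq : ∑ j, q j = 1)
    (hminor : ∀ i j, (1 - c) * q j ≤ P i j) {v : ι → ℝ} (hv : ∑ i, v i = 0) :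
    ∑ j, |(v ᵥ* P) j| ≤ c * ∑ i, |v i| := by
  have hshift (j : ι) : (v ᵥ* P) j = ∑ i, v i * (P i j - (1 - c) * q j) := by
    simp [vecMul, dotProduct, mul_sub, ← Finset.sum_mul, hv]
  calc ∑ j, |(v ᵥ* P) j|
      ≤ ∑ j, ∑ i, |v i| * (P i j - (1 - c) * q j) := by
        refine Finset.sum_le_sum fun j _ => ?_
        rw [hshift]
        refine (Finset.abs_sum_le_sum_abs _ _).trans_eq (Finset.sum_congr rfl fun i _ => ?_)
        rw [abs_mul, abs_of_nonneg (sub_nonneg.2 (hminor i j))]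
    _ = c * ∑ i, |v i| := by
        rw [Finset.sum_comm, Finset.mul_sum]
        refine Finset.sum_congr rfl fun i _ => ?_
        rw [← Finset.mul_sum, Finset.sum_sub_distrib, hProw, ← Finset.mul_sum, hq]
        ring

open Matrix in
lemma sum_abs_vecMul_pow_le_of_minorization {ι : Type*} [Fintype ι] [DecidableEq ι]
    {P : Matrix ι ι ℝ} {q : ι → ℝ} {c : ℝ} (hc : 0 ≤ c) (hProw : ∀ i, ∑ j, P i j = 1)
    (hq : ∑ j, q j = 1) (hminor : ∀ i j, (1 - c) * q j ≤ P i j) {v : ι → ℝ}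
    (hv : ∑ i, v i = 0) (t : ℕ) :
    ∑ j, |(v ᵥ* P ^ t) j| ≤ c ^ t * ∑ i, |v i| := by
  induction t generalizing v with
  | zero => simp
  | succ t ih =>
    rw [pow_succ', ← vecMul_vecMul]
    calc ∑ j, |((v ᵥ* P) ᵥ* P ^ t) j|
        ≤ c ^ t * ∑ i, |(v ᵥ* P) i| := ih ((sum_vecMul_of_row_sum_one hProw v).trans hv)
      _ ≤ c ^ t * (c * ∑ i, |v i|) := by
        gcongr
        exact sum_abs_vecMul_le_of_minorization hProw hq hminor hv
      _ = c ^ (t + 1) * ∑ i, |v i| := by ring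

open Matrix in
lemma vecMul_pow_of_vecMul_eq {ι : Type*} [Fintype ι] [DecidableEq ι] {P : Matrix ι ι ℝ}
    {q : ι → ℝ} (h : q ᵥ* P = q) (t : ℕ) : q ᵥ* P ^ t = q := by
  induction t with
  | zero => simp
  | succ t ih => rw [pow_succ, ← vecMul_vecMul, ih, h]

/-- Let `P` be an `n×n` row-stochastic matrix with a stationary
probability vector `pi` (`piᵀP = piᵀ`), and suppose there is a constant `0 < c < 1`
such that `P i j ≥ (1−c)·pi j` for all `i j`. Then for every probability vector `p`
and every `t ≥ 0`, the distribution after `t` steps satisfies `‖(Pᵗ)ᵀ p − pi‖₁ ≤ 2cᵗ`. -/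
theorem stmt0 {n : ℕ} (P : Matrix (Fin n) (Fin n) ℝ) (pi : Fin n → ℝ)
    (hPnn : ∀ i j, 0 ≤ P i j) (hProw : ∀ i, ∑ j, P i j = 1)
    (hpinn : ∀ i, 0 ≤ pi i) (hpisum : ∑ i, pi i = 1)
    (hstat : ∀ j, ∑ i, pi i * P i j = pi j)
    (c : ℝ) (hc0 : 0 < c) (hc1 : c < 1)
    (hminor : ∀ i j, (1 - c) * pi j ≤ P i j) :
    ∀ p : Fin n → ℝ, (∀ i, 0 ≤ p i) → (∑ i, p i = 1) →
      ∀ t : ℕ, ∑ j, |(∑ i, (P ^ t) i j * p i) - pi j| ≤ 2 * c ^ t := by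
  intro p hpnn hpsum t
  have hdiff (j : Fin n) :
      (∑ i, (P ^ t) i j * p i) - pi j = Matrix.vecMul (p - pi) (P ^ t) j := by
    rw [Matrix.sub_vecMul, vecMul_pow_of_vecMul_eq (funext hstat)]
    simp [Matrix.vecMul, dotProduct, mul_comm]
  have hzero : ∑ i, (p - pi) i = 0 := by simp [hpsum, hpisum]
  have htwo : ∑ i, |(p - pi) i| ≤ 2 := by
    calc ∑ i, |(p - pi) i| ≤ ∑ i, (p i + pi i) := by
          refine Finset.sum_le_sum fun i _ => (abs_sub (p i) (pi i)).trans_eq ?_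
          rw [abs_of_nonneg (hpnn i), abs_of_nonneg (hpinn i)]
      _ = 2 := by rw [Finset.sum_add_distrib, hpsum, hpisum]; norm_num
  simp only [hdiff]
  calc _ ≤ c ^ t * ∑ i, |(p - pi) i| :=
        sum_abs_vecMul_pow_le_of_minorization hc0.le hProw hpisum hminor hzero t
    _ ≤ c ^ t * 2 := by gcongr
    _ = 2 * c ^ t := mul_comm _ _
end

section
/- Let V and Ṽ be finite sets with |V| = n ≥ 1, let f : Ṽ → V be surjective, and let P̃ be a row-stochastic matrix on Ṽ with a stationary probability vector π̃ (π̃ᵀP̃ = π̃ᵀ) such that ∑_{ṽ ∈ f⁻¹(v)} π̃(ṽ) = 1/n for every v ∈ V. Let x(0) : V → ℝ≥0 be initial values with average x_ave = (1/n)∑_v x_v(0), let y(0) : Ṽ → ℝ≥0 satisfy ∑_{ṽ ∈ f⁻¹(v)} y_ṽ(0) = x_v(0) for each v, define y(t+1) = P̃ᵀ y(t), and set x_v(t) = ∑_{ṽ ∈ f⁻¹(v)} y_ṽ(t). If ε > 0 and t is an integer such that ‖(P̃ᵗ)ᵀ q − π̃‖₁ ≤ ε for every probability vector q on Ṽ,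 then ∑_{v ∈ V} |x_v(t) − x_ave| ≤ ε · ∑_{v ∈ V} x_v(0). -/
open Finset

/-- The iterates of `y ↦ Pᵀ y` are given by the powers of `P`. -/
theorem iterate_eq_sum_pow {ι : Type*} [Fintype ι] [DecidableEq ι] (P : Matrix ι ι ℝ)
    (y : ℕ → ι → ℝ) (hy : ∀ t j, y (t + 1) j = ∑ i, P i j * y t i) (t : ℕ) (j : ι) :
    y t j = ∑ i, (P ^ t) i j * y 0 i := by
  induction t generalizing j with
  | zero => simp [Matrix.one_apply]
  | succ t ih =>
    simp only [hy, ih, pow_succ, Matrix.mul_apply, mul_sum, sum_mul]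
    rw [sum_comm]
    exact sum_congr rfl fun _ _ => sum_congr rfl fun _ _ => by ring

/-- An `ℓ₁` bound on probability vectors extends to nonnegative vectors by homogeneity. -/
theorem sum_abs_sub_le_of_prob {ι : Type*} [Fintype ι] (A : Matrix ι ι ℝ) (p : ι → ℝ) (ε : ℝ)
    (hA : ∀ q : ι → ℝ, (∀ i, 0 ≤ q i) → (∑ i, q i = 1) →
      ∑ j, |(∑ i, A i j * q i) - p j| ≤ ε)
    (z : ι → ℝ) (hz : ∀ i, 0 ≤ z i) :
    ∑ j, |(∑ i, A i j * z i) - (∑ i, z i) * p j| ≤ ε * ∑ i, z i := by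
  rcases (sum_nonneg fun i _ => hz i : 0 ≤ ∑ i, z i).eq_or_lt with h | h
  · have hz0 : ∀ i, z i = 0 := fun i =>
      (sum_eq_zero_iff_of_nonneg fun i _ => hz i).1 h.symm i (mem_univ i)
    simp [hz0]
  · set S := ∑ i, z i with hS
    have hq := hA (fun i => z i / S) (fun i => div_nonneg (hz i) h.le)
      (by rw [← sum_div, ← hS, div_self h.ne'])
    refine le_of_eq_of_le ?_ (mul_le_mul_of_nonneg_right hq h.le)
    rw [sum_mul]
    refine sum_congr rfl fun j _ => ?_
    conv_rhs => rw [← abs_of_pos h, ← abs_mul]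
    simp only [← mul_div_assoc, ← sum_div, abs_of_pos h]
    congr 1
    field_simp

/-- Summing over the fibers of a map does not increase the `ℓ₁` norm. -/
theorem sum_abs_sum_fiber_le {ι κ : Type*} [Fintype ι] [Fintype κ] [DecidableEq κ]
    (f : ι → κ) (g : ι → ℝ) :
    ∑ v, |∑ i ∈ univ.filter (fun i => f i = v), g i| ≤ ∑ i, |g i| := by
  rw [← sum_fiberwise univ f fun i => |g i|]
  exact sum_le_sum fun v _ => abs_sum_le_sum_abs _ _

/-- Correctness bound for Pseudo-Algorithm 1 (distributed averaging
via a lifted chain whose collapsed stationary distribution is uniform):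
if every probability vector mixes to within `ε` in ℓ₁ distance by time `t`, then the
node estimates at time `t` satisfy `∑_v |x_v(t) − x_ave| ≤ ε·∑_v x_v(0)`. -/
theorem stmt3 {V Vt : Type*} [Fintype V] [Fintype Vt] [DecidableEq V] [DecidableEq Vt]
    (n : ℕ) (hn : 1 ≤ n) (hcard : Fintype.card V = n)
    (f : Vt → V) (hf : Function.Surjective f)
    (Pt : Matrix Vt Vt ℝ) (pit : Vt → ℝ)
    (hPnn : ∀ i j, 0 ≤ Pt i j) (hProw : ∀ i, ∑ j, Pt i j = 1)
    (hpinn : ∀ i, 0 ≤ pit i) (hpisum : ∑ i, pit i = 1)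
    (hstat : ∀ j, ∑ i, pit i * Pt i j = pit j)
    (hfiber : ∀ v : V, ∑ vt ∈ univ.filter (fun vt => f vt = v), pit vt = 1 / n)
    (x0 : V → ℝ) (hx0 : ∀ v, 0 ≤ x0 v)
    (xave : ℝ) (hxave : xave = (1 / n) * ∑ v, x0 v)
    (y : ℕ → Vt → ℝ) (hy0nn : ∀ vt, 0 ≤ y 0 vt)
    (hy0 : ∀ v : V, ∑ vt ∈ univ.filter (fun vt => f vt = v), y 0 vt = x0 v)
    (hyrec : ∀ t vt, y (t + 1) vt = ∑ ut, Pt ut vt * y t ut)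
    (x : ℕ → V → ℝ)
    (hx : ∀ t v, x t v = ∑ vt ∈ univ.filter (fun vt => f vt = v), y t vt)
    (ε : ℝ) (hε : 0 < ε) (t : ℕ)
    (hmix : ∀ q : Vt → ℝ, (∀ i, 0 ≤ q i) → (∑ i, q i = 1) →
      ∑ j, |(∑ i, (Pt ^ t) i j * q i) - pit j| ≤ ε) :
    ∑ v, |x t v - xave| ≤ ε * ∑ v, x0 v := by
  have hS : ∑ v, x0 v = ∑ i, y 0 i := by
    rw [← sum_fiberwise univ f (y 0)]
    exact sum_congr rfl fun v _ => (hy0 v).symm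
  have hdiff : ∀ v, x t v - xave = ∑ vt ∈ univ.filter (fun vt => f vt = v),
      ((∑ i, (Pt ^ t) i vt * y 0 i) - (∑ i, y 0 i) * pit vt) := fun v => by
    rw [sum_sub_distrib, ← mul_sum, hfiber, hx, hxave, hS, mul_comm (1 / (n : ℝ))]
    simp only [iterate_eq_sum_pow Pt y hyrec t]
  simp only [hdiff]
  rw [hS]
  exact (sum_abs_sum_fiber_le f _).trans
    (sum_abs_sub_le_of_prob (Pt ^ t) pit ε hmix (y 0) hy0nn)
end

section
/- Let V and Ṽ be finite sets with |V| = n ≥ 1, let f : Ṽ → V be surjective, and let P̃ be a row-stochastic matrix on Ṽ with a stationary probability vector π̃ such that for some constant c' > 0, ∑_{ṽ ∈ f⁻¹(v)} π̃(ṽ) ≥ c'/n for every v ∈ V. Let x(0) : V → ℝ≥0 with average x_ave = (1/n)∑_v x_v(0). Let y(0), w(0) : Ṽ → ℝ≥0 satisfy ∑_{ṽ ∈ f⁻¹(v)} y_ṽ(0) = x_v(0) and ∑_{ṽ ∈ f⁻¹(v)} w_ṽ(0) = 1 for each v; define y(t+1) = P̃ᵀ y(t), w(t+1) = P̃ᵀ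 w(t), and x_v(t) = (∑_{ṽ ∈ f⁻¹(v)} y_ṽ(t)) / (∑_{ṽ ∈ f⁻¹(v)} w_ṽ(t)). Let 0 < c < 1 and ε > 0, and suppose t is an integer such that (i) P̃ᵗ(ũ,ṽ) ≥ (1−c)·π̃(ṽ) for all ũ, ṽ ∈ Ṽ, and (ii) ‖(P̃ᵗ)ᵀ q − π̃‖₁ ≤ ε(1−c)c'/2 for every probability vector q on Ṽ. Then the denominators ∑_{ṽ ∈ f⁻¹(v)} w_ṽ(t) are at least (1−c)c' > 0 and ∑_{v ∈ V} |x_v(t) − x_ave| ≤ ε · ∑_{v ∈ V} x_v(0). -/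
open Finset

/-- Iterating `z ↦ Pᵀ z` is multiplication by the transpose of `P ^ t`. -/
lemma iterate_transpose_eq_sum_pow {ι : Type*} [Fintype ι] [DecidableEq ι]
    (P : Matrix ι ι ℝ) (z : ℕ → ι → ℝ)
    (hz : ∀ t j, z (t + 1) j = ∑ i, P i j * z t i) (t : ℕ) (j : ι) :
    z t j = ∑ i, (P ^ t) i j * z 0 i := by
  induction t generalizing j with
  | zero => simp [Matrix.one_apply]
  | succ t ih =>
    simp only [hz, ih, pow_succ, Matrix.mul_apply, Finset.mul_sum, Finset.sum_mul]
    rw [Finset.sum_comm]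
    exact sum_congr rfl fun i _ => sum_congr rfl fun k _ => by ring

/-- An `ℓ₁` bound for probability vectors extends to nonnegative vectors by homogeneity. -/
lemma sum_abs_sub_le_of_forall_prob {ι : Type*} [Fintype ι]
    (M : Matrix ι ι ℝ) (p : ι → ℝ) (δ : ℝ)
    (hM : ∀ q : ι → ℝ, (∀ i, 0 ≤ q i) → (∑ i, q i = 1) →
      ∑ j, |(∑ i, M i j * q i) - p j| ≤ δ)
    (z : ι → ℝ) (hz : ∀ i, 0 ≤ z i) :
    ∑ j, |(∑ i, M i j * z i) - (∑ i, z i) * p j| ≤ (∑ i, z i) * δ := by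
  obtain ⟨S, hS⟩ : ∃ S, S = ∑ i, z i := ⟨_, rfl⟩
  have hS0 : 0 ≤ S := hS ▸ sum_nonneg fun i _ => hz i
  rw [← hS]
  rcases hS0.eq_or_lt with rfl | hpos
  · have hz0 : ∀ i, z i = 0 := fun i =>
      (sum_eq_zero_iff_of_nonneg fun i _ => hz i).1 hS.symm i (mem_univ i)
    simp [hz0]
  · have hq := hM (fun i => z i / S) (fun i => div_nonneg (hz i) hpos.le)
      (by rw [← sum_div, ← hS, div_self hpos.ne'])
    refine le_trans (le_of_eq ?_) (mul_le_mul_of_nonneg_left hq hpos.le)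
    rw [mul_sum]
    refine sum_congr rfl fun j _ => ?_
    have hscale : ∑ i, M i j * z i = S * ∑ i, M i j * (z i / S) := by
      rw [mul_sum]
      exact sum_congr rfl fun i _ => by field_simp
    rw [hscale, ← mul_sub, abs_mul, abs_of_pos hpos]

/-- Summing over the fibers of a map does not increase the `ℓ₁` distance. -/
lemma sum_abs_fiber_sub_le {ι κ : Type*} [Fintype ι] [Fintype κ] [DecidableEq κ]
    (f : ι → κ) (a b : ι → ℝ) :
    ∑ v, |(∑ i ∈ univ.filter (fun i => f i = v), a i) -
      ∑ i ∈ univ.filter (fun i => f i = v), b i| ≤ ∑ i, |a i - b i| := by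
  rw [← sum_fiberwise univ f fun i => |a i - b i|]
  refine sum_le_sum fun v _ => ?_
  rw [← sum_sub_distrib]
  exact abs_sum_le_sum_abs _ _

/-- If `W ≥ d > 0`, the error of the quotient `Y / W` is controlled by the errors of `Y`
and `W`. -/
lemma abs_div_sub_le {Y W m a d : ℝ} (hd : 0 < d) (hW : d ≤ W) (hm : 0 ≤ m) :
    |Y / W - m| ≤ (|Y - m * a| + m * |W - a|) / d := by
  have hWpos : 0 < W := hd.trans_le hW
  have heq : Y / W - m = ((Y - m * a) - m * (W - a)) / W := by field_simp; ring
  rw [heq, abs_div, abs_of_pos hWpos]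
  have hnum : |(Y - m * a) - m * (W - a)| ≤ |Y - m * a| + m * |W - a| := by
    refine (abs_sub _ _).trans (le_of_eq ?_)
    rw [abs_mul, abs_of_nonneg hm]
  gcongr

/-- Correctness bound for Pseudo-Algorithm 2 (distributed averaging
via a lifted chain with weight variables compensating a non-uniform stationary
distribution): under the fill-time condition (i) and the mixing condition (ii) at
time `t`, the denominators `∑_{f ṽ = v} w_ṽ(t)` are at least `(1−c)c'` and the
estimates satisfy `∑_v |x_v(t) − x_ave| ≤ ε·∑_v x_v(0)`. -/
theorem stmt4 {V Vt : Type*} [Fintype V] [Fintype Vt] [DecidableEq V] [DecidableEq Vt]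
    (n : ℕ) (hn : 1 ≤ n) (hcard : Fintype.card V = n)
    (f : Vt → V) (hf : Function.Surjective f)
    (Pt : Matrix Vt Vt ℝ) (pit : Vt → ℝ)
    (hPnn : ∀ i j, 0 ≤ Pt i j) (hProw : ∀ i, ∑ j, Pt i j = 1)
    (hpinn : ∀ i, 0 ≤ pit i) (hpisum : ∑ i, pit i = 1)
    (hstat : ∀ j, ∑ i, pit i * Pt i j = pit j)
    (c' : ℝ) (hc' : 0 < c')
    (hfiber : ∀ v : V, c' / n ≤ ∑ vt ∈ univ.filter (fun vt => f vt = v), pit vt)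
    (x0 : V → ℝ) (hx0 : ∀ v, 0 ≤ x0 v)
    (xave : ℝ) (hxave : xave = (1 / n) * ∑ v, x0 v)
    (y w : ℕ → Vt → ℝ) (hy0nn : ∀ vt, 0 ≤ y 0 vt) (hw0nn : ∀ vt, 0 ≤ w 0 vt)
    (hy0 : ∀ v : V, ∑ vt ∈ univ.filter (fun vt => f vt = v), y 0 vt = x0 v)
    (hw0 : ∀ v : V, ∑ vt ∈ univ.filter (fun vt => f vt = v), w 0 vt = 1)
    (hyrec : ∀ t vt, y (t + 1) vt = ∑ ut, Pt ut vt * y t ut)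
    (hwrec : ∀ t vt, w (t + 1) vt = ∑ ut, Pt ut vt * w t ut)
    (x : ℕ → V → ℝ)
    (hx : ∀ t v, x t v =
      (∑ vt ∈ univ.filter (fun vt => f vt = v), y t vt) /
      (∑ vt ∈ univ.filter (fun vt => f vt = v), w t vt))
    (c : ℝ) (hc0 : 0 < c) (hc1 : c < 1) (ε : ℝ) (hε : 0 < ε) (t : ℕ)
    (hfill : ∀ ut vt, (1 - c) * pit vt ≤ (Pt ^ t) ut vt)
    (hmix : ∀ q : Vt → ℝ, (∀ i, 0 ≤ q i) → (∑ i, q i = 1) →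
      ∑ j, |(∑ i, (Pt ^ t) i j * q i) - pit j| ≤ ε * (1 - c) * c' / 2) :
    (∀ v : V, (1 - c) * c' ≤ ∑ vt ∈ univ.filter (fun vt => f vt = v), w t vt) ∧
      ∑ v, |x t v - xave| ≤ ε * ∑ v, x0 v := by
  have hn0 : (0 : ℝ) < n := by exact_mod_cast hn
  have hc1' : 0 < 1 - c := sub_pos.2 hc1
  have hd : 0 < (1 - c) * c' := mul_pos hc1' hc'
  have hwsum : ∑ i, w 0 i = n := by
    rw [← sum_fiberwise univ f (w 0), sum_congr rfl fun v _ => hw0 v]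
    simp [hcard]
  have hysum : ∑ i, y 0 i = ∑ v, x0 v := by
    rw [← sum_fiberwise univ f (y 0), sum_congr rfl fun v _ => hy0 v]
  have hw := iterate_transpose_eq_sum_pow Pt w hwrec t
  have hy := iterate_transpose_eq_sum_pow Pt y hyrec t
  have hden : ∀ v : V, (1 - c) * c' ≤ ∑ vt ∈ univ.filter (fun vt => f vt = v), w t vt := by
    intro v
    calc (1 - c) * c' = (1 - c) * n * (c' / n) := by field_simp
      _ ≤ (1 - c) * n * ∑ vt ∈ univ.filter (fun vt => f vt = v), pit vt :=
        mul_le_mul_of_nonneg_left (hfiber v) (by positivity)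
      _ = ∑ vt ∈ univ.filter (fun vt => f vt = v), ∑ i, (1 - c) * pit vt * w 0 i := by
        rw [mul_sum]
        refine sum_congr rfl fun vt _ => ?_
        rw [← mul_sum, hwsum]
        ring
      _ ≤ ∑ vt ∈ univ.filter (fun vt => f vt = v), w t vt := by
        refine sum_le_sum fun vt _ => ?_
        rw [hw]
        exact sum_le_sum fun i _ => mul_le_mul_of_nonneg_right (hfill i vt) (hw0nn i)
  refine ⟨hden, ?_⟩
  have hS : n * xave = ∑ v, x0 v := by rw [hxave]; field_simp
  have hm : 0 ≤ xave := by
    rw [hxave]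
    exact mul_nonneg (by positivity) (sum_nonneg fun v _ => hx0 v)
  have hyerr := (sum_abs_fiber_sub_le f (y t) fun j => (∑ i, y 0 i) * pit j).trans <| by
    simpa only [← hy] using sum_abs_sub_le_of_forall_prob (Pt ^ t) pit _ hmix (y 0) hy0nn
  have hwerr := (sum_abs_fiber_sub_le f (w t) fun j => (∑ i, w 0 i) * pit j).trans <| by
    simpa only [← hw] using sum_abs_sub_le_of_forall_prob (Pt ^ t) pit _ hmix (w 0) hw0nn
  simp only [hysum, hwsum, ← mul_sum, ← hS] at hyerr hwerr
  calc ∑ v, |x t v - xave|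
      ≤ ∑ v, (|(∑ vt ∈ univ.filter (fun vt => f vt = v), y t vt) -
            n * xave * ∑ vt ∈ univ.filter (fun vt => f vt = v), pit vt| +
          xave * |(∑ vt ∈ univ.filter (fun vt => f vt = v), w t vt) -
            n * ∑ vt ∈ univ.filter (fun vt => f vt = v), pit vt|) / ((1 - c) * c') := by
        refine sum_le_sum fun v _ => ?_
        rw [hx, mul_comm (n : ℝ) xave, mul_assoc]
        exact abs_div_sub_le hd (hden v) hm
    _ ≤ (n * xave * (ε * (1 - c) * c' / 2) + xave * (n * (ε * (1 - c) * c' / 2))) /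
          ((1 - c) * c') := by
        rw [← sum_div, sum_add_distrib, ← mul_sum]
        gcongr
    _ = ε * ∑ v, x0 v := by
        rw [← hS]
        field_simp
        ring
end

section
/- For every integer k ≥ 3 and all states s₀, s of the grid chain, the 6k-step transition probability satisfies P̃^{6k}(s₀, s) ≥ 2^{−12}/(4k²). (In particular the fill time of the grid chain is at most 6k for the constant c = 1 − 2^{−12}.) -/
/-- One move of the grid random walk on the `k × k` grid: from position `(x, y)`
heading in direction `d` (`0 = E`, `1 = N`, `2 = W`, `3 = S`), move one step in
direction `d`, bouncing back (reversing direction while staying at the same node)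
at the boundary. -/
def gridMove {k : ℕ} (x y : Fin k) (d : Fin 4) : Fin k × Fin k × Fin 4 :=
  if d = 0 then
    if h : (x : ℕ) + 1 < k then (⟨(x : ℕ) + 1, h⟩, y, 0) else (x, y, 2)
  else if d = 1 then
    if h : (y : ℕ) + 1 < k then (x, ⟨(y : ℕ) + 1, h⟩, 1) else (x, y, 3)
  else if d = 2 then
    if 0 < (x : ℕ) then (⟨(x : ℕ) - 1, lt_of_le_of_lt (Nat.sub_le _ _) x.isLt⟩, y, 2)
    else (x, y, 0)
  else
    if 0 < (y : ℕ) then (x, ⟨(y : ℕ) - 1, lt_of_le_of_lt (Nat.sub_le _ _) y.isLt⟩, 3)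
    else (x, y, 1)

/-- The nonreversible grid chain `P̃` on the state space
`{0,…,k−1} × {0,…,k−1} × {E,N,W,S}`: with probability `1 − 1/k` keep the current
direction (bouncing at the boundary), and with probability `1/(2k)` each make a
90-degree turn to either side, moving one step in the turned direction (a turn
toward a nonexistent neighbor being redirected to the corresponding state of the
current node). -/
noncomputable def gridChain (k : ℕ) :
    Matrix (Fin k × Fin k × Fin 4) (Fin k × Fin k × Fin 4) ℝ := fun s s' =>
  (1 - 1 / (k : ℝ)) * (if gridMove s.1 s.2.1 s.2.2 = s' then 1 else 0)
    + (1 / (2 * (k : ℝ))) * (if gridMove s.1 s.2.1 (s.2.2 + 1) = s' then 1 else 0)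
    + (1 / (2 * (k : ℝ))) * (if gridMove s.1 s.2.1 (s.2.2 + 3) = s' then 1 else 0)

/-- The coordinate visited at time `p` by the deterministic walk that bounces back and forth on
`{0,…,k−1}`, spending two time units at each end; it has period `2k`. -/
def bounce (k : ℕ) [NeZero k] (p : ℤ) : Fin k :=
  ⟨(if p % (2 * k) < k then p % (2 * k) else 2 * k - 1 - p % (2 * k)).toNat, by
    have hk : 0 < k := Nat.pos_of_neZero k
    have h₀ := Int.emod_nonneg p (b := 2 * k) (by lia)
    have h₁ := Int.emod_lt_of_pos p (b := 2 * k) (by lia)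
    split_ifs <;> lia⟩

/-- The state at time `p` of the walk that never turns and runs along the line of index `z`:
a column if `o` is true, a row otherwise. -/
def lineState {k : ℕ} [NeZero k] (o : Bool) (z : Fin k) (p : ℤ) : Fin k × Fin k × Fin 4 :=
  if o then (z, bounce k p, if p % (2 * k) < k then 1 else 3)
  else (bounce k p, z, if p % (2 * k) < k then 0 else 2)

lemma natCast_emod_two_mul {k : ℕ} (z : Fin k) : ((z : ℕ) : ℤ) % (2 * k) = z :=
  Int.emod_eq_of_lt (by lia) (by have := z.isLt; lia)

/-- The successor of `s` when its direction is increased by `e`. -/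
def turnMove {k : ℕ} (e : Fin 4) (s : Fin k × Fin k × Fin 4) : Fin k × Fin k × Fin 4 :=
  gridMove s.1 s.2.1 (s.2.2 + e)

lemma gridChain_pow_succ_apply {k : ℕ} (n : ℕ) (s t : Fin k × Fin k × Fin 4) :
    (gridChain k ^ (n + 1)) s t = (1 - 1 / (k : ℝ)) * (gridChain k ^ n) (turnMove 0 s) t
      + 1 / (2 * (k : ℝ)) * (gridChain k ^ n) (turnMove 1 s) t
      + 1 / (2 * (k : ℝ)) * (gridChain k ^ n) (turnMove 3 s) t := by
  rw [pow_succ', Matrix.mul_apply]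
  simp [gridChain, turnMove, add_mul, Finset.sum_add_distrib, mul_assoc]

lemma one_sub_one_div_le_one {k : ℕ} : 1 - 1 / (k : ℝ) ≤ 1 := by
  have : 0 ≤ 1 / (k : ℝ) := by positivity
  linarith

section Walk

variable {k : ℕ} [NeZero k]

lemma bounce_congr {p q : ℤ} (h : p % (2 * k) = q % (2 * k)) : bounce k p = bounce k q := by
  simp only [bounce, h]

lemma lineState_congr (o : Bool) (z : Fin k) {p q : ℤ} (h : p % (2 * k) = q % (2 * k)) :
    lineState o z p = lineState o z q := by
  simp only [lineState, bounce, h]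

lemma neg_one_sub_emod (p : ℤ) : (-1 - p) % (2 * k) = 2 * k - 1 - p % (2 * k) := by
  have hk : 0 < k := Nat.pos_of_neZero k
  have h₀ := Int.emod_nonneg p (b := 2 * k) (by lia)
  have h₁ := Int.emod_lt_of_pos p (b := 2 * k) (by lia)
  have h₂ : -1 - p = 2 * k - 1 - p % (2 * k) + 2 * k * (-1 - p / (2 * k)) := by
    linear_combination Int.emod_add_mul_ediv p (2 * k)
  rw [h₂, Int.add_mul_emod_self_left, Int.emod_eq_of_lt (by lia) (by lia)]

lemma bounce_neg_one_sub (p : ℤ) : bounce k (-1 - p) = bounce k p := by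
  ext
  simp only [bounce, neg_one_sub_emod]
  split_ifs <;> lia

lemma bounce_natCast (z : Fin k) : bounce k ((z : ℕ) : ℤ) = z := by
  ext
  have := z.isLt
  simp only [bounce, natCast_emod_two_mul]
  split_ifs <;> lia

lemma add_one_emod_two_mul (p : ℤ) :
    (p + 1) % (2 * k) = if p % (2 * k) = 2 * k - 1 then 0 else p % (2 * k) + 1 := by
  have hk : 0 < k := Nat.pos_of_neZero k
  have h₀ := Int.emod_nonneg p (b := 2 * k) (by lia)
  have h₁ := Int.emod_lt_of_pos p (b := 2 * k) (by lia)
  rw [← Int.emod_add_emod]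
  split_ifs with h
  · rw [h, sub_add_cancel, Int.emod_self]
  · exact Int.emod_eq_of_lt (by lia) (by lia)

lemma exists_eq_lineState (s : Fin k × Fin k × Fin 4) :
    ∃ (o : Bool) (q p : ℤ), s = lineState o (bounce k q) p := by
  obtain ⟨x, y, d⟩ := s
  have hx := natCast_emod_two_mul x
  have hy := natCast_emod_two_mul y
  have hx' := x.isLt
  have hy' := y.isLt
  fin_cases d
  · refine ⟨false, (y : ℕ), (x : ℕ), ?_⟩
    simp only [lineState, bounce_natCast, hx]
    simp
  · refine ⟨true, (x : ℕ), (y : ℕ), ?_⟩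
    simp only [lineState, bounce_natCast, hy]
    simp
  · refine ⟨false, (y : ℕ), -1 - (x : ℕ), ?_⟩
    simp only [lineState, bounce_neg_one_sub, bounce_natCast, neg_one_sub_emod, hx]
    have h : ¬ (2 * (k : ℤ) - 1 - (x : ℕ) < k) := by omega
    simp [h]
  · refine ⟨true, (x : ℕ), -1 - (y : ℕ), ?_⟩
    simp only [lineState, bounce_neg_one_sub, bounce_natCast, neg_one_sub_emod, hy]
    have h : ¬ (2 * (k : ℤ) - 1 - (y : ℕ) < k) := by omega
    simp [h]

lemma gridMove_bounce_row (z : Fin k) (p : ℤ) :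
    gridMove (bounce k p) z (if p % (2 * k) < k then 0 else 2) = lineState false z (p + 1) := by
  have hk : 0 < k := Nat.pos_of_neZero k
  have h₀ := Int.emod_nonneg p (b := 2 * k) (by lia)
  have h₁ := Int.emod_lt_of_pos p (b := 2 * k) (by lia)
  obtain ⟨m, hm⟩ : ∃ m, p % (2 * k) = m := ⟨_, rfl⟩
  simp only [lineState, gridMove, bounce, add_one_emod_two_mul, hm] at h₀ h₁ ⊢
  split_ifs <;> simp_all <;> lia

lemma gridMove_bounce_col (z : Fin k) (p : ℤ) :
    gridMove z (bounce k p) (if p % (2 * k) < k then 1 else 3) = lineState true z (p + 1) := by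
  have hk : 0 < k := Nat.pos_of_neZero k
  have h₀ := Int.emod_nonneg p (b := 2 * k) (by lia)
  have h₁ := Int.emod_lt_of_pos p (b := 2 * k) (by lia)
  obtain ⟨m, hm⟩ : ∃ m, p % (2 * k) = m := ⟨_, rfl⟩
  simp only [lineState, gridMove, bounce, add_one_emod_two_mul, hm] at h₀ h₁ ⊢
  split_ifs <;> simp_all <;> lia

lemma turnMove_zero_lineState (o : Bool) (z : Fin k) (p : ℤ) :
    turnMove 0 (lineState o z p) = lineState o z (p + 1) := by
  cases o
  · simpa [turnMove, lineState] using gridMove_bounce_row z p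
  · simpa [turnMove, lineState] using gridMove_bounce_col z p

lemma turnMove_lineState (o : Bool) (q p : ℤ) :
    turnMove 1 (lineState o (bounce k q) p) = lineState (!o) (bounce k p) (q + 1) ∨
      turnMove 3 (lineState o (bounce k q) p) = lineState (!o) (bounce k p) (q + 1) := by
  cases o
  · have h := gridMove_bounce_col (bounce k p) q
    simp only [turnMove, lineState, Bool.false_eq_true, if_false, Bool.not_false, if_true] at h ⊢
    rw [← h]
    by_cases h₁ : p % (2 * k) < k <;> by_cases h₂ : q % (2 * k) < k <;> simp [h₁, h₂]
  · have h := gridMove_bounce_row (bounce k p) q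
    simp only [turnMove, lineState, Bool.false_eq_true, if_false, Bool.not_true, if_true] at h ⊢
    rw [← h]
    by_cases h₁ : p % (2 * k) < k <;> by_cases h₂ : q % (2 * k) < k <;> simp [h₁, h₂]

lemma one_sub_one_div_nonneg : (0 : ℝ) ≤ 1 - 1 / k := by
  have hk : (1 : ℝ) ≤ k := by exact_mod_cast Nat.pos_of_neZero k
  rw [sub_nonneg, div_le_one (by positivity)]
  exact hk

lemma gridChain_pow_nonneg (n : ℕ) (s t : Fin k × Fin k × Fin 4) :
    0 ≤ (gridChain k ^ n) s t := by
  induction n generalizing s with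
  | zero => rw [pow_zero, Matrix.one_apply]; split_ifs <;> norm_num
  | succ n ih =>
    rw [gridChain_pow_succ_apply]
    have := one_sub_one_div_nonneg (k := k)
    have := ih (turnMove 0 s)
    have := ih (turnMove 1 s)
    have := ih (turnMove 3 s)
    positivity

lemma straight_add_turn_le (n : ℕ) (o : Bool) (q p : ℤ) (t : Fin k × Fin k × Fin 4) :
    (1 - 1 / (k : ℝ)) * (gridChain k ^ n) (lineState o (bounce k q) (p + 1)) t
      + 1 / (2 * (k : ℝ)) * (gridChain k ^ n) (lineState (!o) (bounce k p) (q + 1)) t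
      ≤ (gridChain k ^ (n + 1)) (lineState o (bounce k q) p) t := by
  rw [gridChain_pow_succ_apply, turnMove_zero_lineState]
  have h₁ := gridChain_pow_nonneg n (turnMove 1 (lineState o (bounce k q) p)) t
  have h₃ := gridChain_pow_nonneg n (turnMove 3 (lineState o (bounce k q) p)) t
  have hh : (0 : ℝ) ≤ 1 / (2 * k) := by positivity
  rcases turnMove_lineState (k := k) o q p with h | h <;> rw [← h]
  · linarith [mul_nonneg hh h₃]
  · linarith [mul_nonneg hh h₁]

lemma turn_le (n : ℕ) (o : Bool) (q p : ℤ) (t : Fin k × Fin k × Fin 4) :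
    1 / (2 * (k : ℝ)) * (gridChain k ^ n) (lineState (!o) (bounce k p) (q + 1)) t
      ≤ (gridChain k ^ (n + 1)) (lineState o (bounce k q) p) t := by
  refine le_trans (le_add_of_nonneg_left ?_) (straight_add_turn_le n o q p t)
  exact mul_nonneg one_sub_one_div_nonneg (gridChain_pow_nonneg _ _ _)

lemma straight_le (n m : ℕ) (o : Bool) (q p : ℤ) (t : Fin k × Fin k × Fin 4) :
    (1 - 1 / (k : ℝ)) ^ m * (gridChain k ^ n) (lineState o (bounce k q) (p + m)) t
      ≤ (gridChain k ^ (n + m)) (lineState o (bounce k q) p) t := by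
  induction m generalizing p with
  | zero => simp
  | succ m ih =>
    have h : p + ((m + 1 : ℕ) : ℤ) = p + 1 + m := by push_cast; ring
    rw [h, pow_succ', mul_assoc]
    refine le_trans (mul_le_mul_of_nonneg_left (ih (p + 1)) one_sub_one_div_nonneg) ?_
    refine le_trans (le_add_of_nonneg_right ?_) (straight_add_turn_le (n + m) o q p t)
    exact mul_nonneg (by positivity) (gridChain_pow_nonneg _ _ _)

/-- A path turning twice, after `a` and after `a + b + 1` steps, the second time reversing the
original sense of motion. -/
lemma two_turns_le (a b c : ℕ) (o : Bool) (q p : ℤ) :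
    (1 / (2 * (k : ℝ))) ^ 2 * (1 - 1 / (k : ℝ)) ^ (a + b + c)
      ≤ (gridChain k ^ (c + 1 + b + 1 + a)) (lineState o (bounce k q) p)
          (lineState o (bounce k (q + 1 + b)) (-1 - (p + a) + 1 + c)) := by
  set t := lineState o (bounce k (q + 1 + b)) (-1 - (p + a) + 1 + c) with ht
  have hr := one_sub_one_div_nonneg (k := k)
  have hh : (0 : ℝ) ≤ 1 / (2 * k) := by positivity
  have h₁ := straight_le (c + 1 + b + 1) a o q p t
  have h₂ := turn_le (c + 1 + b) o q (p + a) t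
  have h₃ := straight_le (c + 1) b (!o) (p + a) (q + 1) t
  have h₄ := turn_le c (!o) (-1 - (p + a)) (q + 1 + b) t
  have h₅ := straight_le 0 c o (q + 1 + b) (-1 - (p + a) + 1) t
  rw [bounce_neg_one_sub, Bool.not_not] at h₄
  rw [pow_zero, ← ht, Matrix.one_apply_eq, mul_one, zero_add] at h₅
  calc _ = (1 - 1 / (k : ℝ)) ^ a * (1 / (2 * k) * ((1 - 1 / (k : ℝ)) ^ b *
        (1 / (2 * k) * (1 - 1 / (k : ℝ)) ^ c))) := by ring
    _ ≤ _ := by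
      refine le_trans ?_ h₁
      gcongr
      refine le_trans ?_ h₂
      gcongr
      refine le_trans ?_ h₃
      gcongr
      refine le_trans ?_ h₄
      gcongr

lemma two_turns_lower_bound {T : ℕ} (hT : 3 * k ≤ T) (o : Bool) (q p q' p' : ℤ) :
    (1 / (2 * (k : ℝ))) ^ 2 * (1 - 1 / (k : ℝ)) ^ T
      ≤ (gridChain k ^ T) (lineState o (bounce k q) p) (lineState o (bounce k q') p') := by
  have hk : 0 < k := Nat.pos_of_neZero k
  wlog hpar : 2 ∣ (T - 1 - p - p' - (q' - q) : ℤ) generalizing q'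
  · rw [← bounce_neg_one_sub q']
    exact this _ (by lia)
  -- the number `b + 1` of steps on the intermediate line, and the number `a` of steps before it
  obtain ⟨b, hb⟩ := Int.eq_ofNat_of_zero_le
    (Int.emod_nonneg (q' - q - 1) (b := 2 * k) (by lia))
  have hb_lt := Int.emod_lt_of_pos (q' - q - 1) (b := 2 * k) (by lia)
  have hb_div := Int.emod_add_mul_ediv (q' - q - 1) (2 * k)
  rw [hb] at hb_lt hb_div
  obtain ⟨m, hm⟩ : 2 ∣ (T - (b + 1) - 1 - p - p' : ℤ) := by
    have : (T - (b + 1) - 1 - p - p' : ℤ)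
        = T - 1 - p - p' - (q' - q) + 2 * (k * ((q' - q - 1) / (2 * k))) := by
      linear_combination -hb_div
    rw [this]
    exact dvd_add hpar (dvd_mul_right _ _)
  obtain ⟨a, ha⟩ := Int.eq_ofNat_of_zero_le (Int.emod_nonneg m (b := k) (by lia))
  have ha_lt := Int.emod_lt_of_pos m (b := k) (by lia)
  have ha_div := Int.emod_add_mul_ediv m k
  rw [ha] at ha_lt ha_div
  obtain ⟨c, rfl⟩ : ∃ c, T = c + 1 + b + 1 + a := ⟨T - (b + 1) - a - 1, by lia⟩
  have hq : bounce k (q + 1 + b) = bounce k q' := by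
    apply bounce_congr
    rw [Int.emod_eq_emod_iff_emod_sub_eq_zero]
    apply Int.emod_eq_zero_of_dvd
    exact ⟨-((q' - q - 1) / (2 * k)), by linear_combination hb_div⟩
  have hp : lineState o (bounce k q') (-1 - (p + a) + 1 + c) = lineState o (bounce k q') p' := by
    apply lineState_congr
    rw [Int.emod_eq_emod_iff_emod_sub_eq_zero]
    apply Int.emod_eq_zero_of_dvd
    refine ⟨m / k, ?_⟩
    push_cast at hm
    linear_combination hm - 2 * ha_div
  rw [← hp, ← hq]
  refine le_trans (mul_le_mul_of_nonneg_left ?_ (by positivity)) (two_turns_le a b c o q p)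
  exact pow_le_pow_of_le_one one_sub_one_div_nonneg one_sub_one_div_le_one (by lia)

/-- Summing over the `i` possible times of the first of three turns. -/
lemma three_turns_lower_bound (i : ℕ) {T : ℕ} (hT : 3 * k + i ≤ T) (o : Bool) (q p q' p' : ℤ) :
    i * ((1 / (2 * (k : ℝ))) ^ 3 * (1 - 1 / (k : ℝ)) ^ T)
      ≤ (gridChain k ^ T) (lineState o (bounce k q) p) (lineState (!o) (bounce k q') p') := by
  induction i generalizing T p with
  | zero => simpa using gridChain_pow_nonneg _ _ _
  | succ i ih =>
    obtain ⟨T, rfl⟩ : ∃ T', T = T' + 1 := ⟨T - 1, by lia⟩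
    have hr := one_sub_one_div_nonneg (k := k)
    have hr₁ := one_sub_one_div_le_one (k := k)
    have hh : (0 : ℝ) ≤ 1 / (2 * k) := by positivity
    have h₁ := mul_le_mul_of_nonneg_left (ih (T := T) (by lia) (p + 1)) hr
    have h₂ := mul_le_mul_of_nonneg_left
      (two_turns_lower_bound (k := k) (T := T) (by lia) (!o) p (q + 1) q' p') hh
    refine le_trans ?_ (le_trans (add_le_add h₁ h₂) (straight_add_turn_le T o q p _))
    have h₃ : (1 / (2 * (k : ℝ))) ^ 3 * ((1 - 1 / (k : ℝ)) ^ T * (1 - 1 / k))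
        ≤ (1 / (2 * (k : ℝ))) ^ 3 * ((1 - 1 / (k : ℝ)) ^ T * 1) := by gcongr
    rw [Nat.cast_succ, pow_succ _ T]
    linarith

end Walk

lemma one_fourth_le_one_sub_one_div_pow {k : ℕ} (hk : 2 ≤ k) :
    1 / 4 ≤ (1 - 1 / (k : ℝ)) ^ k := by
  have hk' : (2 : ℝ) ≤ k := by exact_mod_cast hk
  have hr : (0 : ℝ) ≤ 1 - 1 / k := by
    rw [sub_nonneg, div_le_one (by positivity)]
    linarith
  have h := one_add_mul_self_le_rpow_one_add (s := -(1 / (k : ℝ))) (by linarith)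
    (p := (k : ℝ) / 2) (by linarith)
  rw [← sub_eq_add_neg, show 1 + (k : ℝ) / 2 * -(1 / k) = 1 / 2 by field_simp; norm_num] at h
  calc (1 / 4 : ℝ) = (1 / 2) ^ 2 := by norm_num
    _ ≤ ((1 - 1 / (k : ℝ)) ^ ((k : ℝ) / 2)) ^ 2 := by gcongr
    _ = (1 - 1 / (k : ℝ)) ^ k := by
      rw [← Real.rpow_mul_natCast hr, Nat.cast_ofNat, div_mul_cancel₀ _ two_ne_zero,
        Real.rpow_natCast]

/-- For every `k ≥ 3` and all states `s₀, s` of the grid chain, the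
`6k`-step transition probability satisfies `P̃^{6k}(s₀,s) ≥ 2^{−12}/(4k²)`; in
particular the fill time of the grid chain is at most `6k` for `c = 1 − 2^{−12}`. -/
theorem stmt6 (k : ℕ) (hk : 3 ≤ k) (s₀ s : Fin k × Fin k × Fin 4) :
    (2 : ℝ) ^ (-12 : ℤ) / (4 * (k : ℝ) ^ 2) ≤ (gridChain k ^ (6 * k)) s₀ s := by
  have : NeZero k := ⟨by lia⟩
  have hk₀ : (0 : ℝ) < k := by exact_mod_cast Nat.pos_of_neZero k
  have hpow : (2 : ℝ) ^ (-12 : ℤ) ≤ (1 - 1 / (k : ℝ)) ^ (6 * k) := by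
    rw [mul_comm, pow_mul]
    calc (2 : ℝ) ^ (-12 : ℤ) = (1 / 4) ^ 6 := by norm_num
      _ ≤ _ := by
        gcongr
        exact one_fourth_le_one_sub_one_div_pow (by lia)
  have hle : (2 : ℝ) ^ (-12 : ℤ) / (4 * (k : ℝ) ^ 2)
      ≤ (1 / (2 * (k : ℝ))) ^ 2 * (1 - 1 / (k : ℝ)) ^ (6 * k) := by
    calc _ = (1 / (2 * (k : ℝ))) ^ 2 * 2 ^ (-12 : ℤ) := by field_simp; norm_num
      _ ≤ _ := by gcongr
  obtain ⟨o, q, p, rfl⟩ := exists_eq_lineState s₀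
  obtain ⟨o', q', p', rfl⟩ := exists_eq_lineState s
  rcases Bool.eq_or_eq_not o' o with rfl | rfl
  · exact hle.trans (two_turns_lower_bound (by lia) _ _ _ _ _)
  · refine (hle.trans ?_).trans (three_turns_lower_bound (3 * k) (by lia) _ _ _ _ _)
    have hr : 0 ≤ (1 / (2 * (k : ℝ))) ^ 2 * (1 - 1 / (k : ℝ)) ^ (6 * k) :=
      mul_nonneg (by positivity) (pow_nonneg one_sub_one_div_nonneg _)
    calc _ ≤ 3 / 2 * ((1 / (2 * (k : ℝ))) ^ 2 * (1 - 1 / (k : ℝ)) ^ (6 * k)) := by linarith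
      _ = _ := by push_cast; field_simp
end

section
/- Let k ≥ 3 be an integer, let x(0) : {0,…,k−1}² → ℝ≥0 be initial node values with average x_ave = k^{−2} ∑_v x_v(0), and run the LADA algorithm on the k×k grid. Set c = 1 − 2^{−12}. For every ε > 0 and every integer t ≥ 6k·(log(2/ε)/log(1/c) + 1), the estimates satisfy ∑_{v} |x_v(t) − x_ave| ≤ ε · ∑_v x_v(0). Hence the ε-averaging time of the LADA algorithm on the k×k grid is O(k·log(ε⁻¹)). -/
namespace GridChain

open Matrix

/-! ### Unfolding the bouncing motion

A coordinate together with its heading is a point of a cycle of length `2k`, on which the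
bouncing motion is a rotation. -/

/-- The cycle of length `2k`, unrolled to `ℤ`, folded onto the path `{0,…,k−1}`. -/
def fold {k : ℕ} (hk : 0 < k) (U : ℤ) : Fin k :=
  ⟨(min (U % (2 * k)) (2 * k - 1 - U % (2 * k))).toNat, by
    have h1 := Int.emod_nonneg U (b := 2 * (k : ℤ)) (by omega)
    have h2 := Int.emod_lt_of_pos U (b := 2 * (k : ℤ)) (by omega)
    omega⟩

/-- The state moving horizontally (`m = true`) or vertically (`m = false`) with unfolded
coordinate `U` along the direction of motion and `V` across it. -/
def lift {k : ℕ} (hk : 0 < k) (m : Bool) (U V : ℤ) : Fin k × Fin k × Fin 4 :=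
  if m then (fold hk U, fold hk V, if U % (2 * k) < k then 0 else 2)
  else (fold hk V, fold hk U, if U % (2 * k) < k then 1 else 3)

lemma fold_reflect {k : ℕ} (hk : 0 < k) (U : ℤ) : fold hk (-1 - U) = fold hk U := by
  have h : (-1 - U) % (2 * k) = 2 * k - 1 - U % (2 * k) := by
    have h1 := Int.emod_nonneg U (b := 2 * (k : ℤ)) (by omega)
    have h2 := Int.emod_lt_of_pos U (b := 2 * (k : ℤ)) (by omega)
    have h3 := Int.emod_add_mul_ediv U (2 * k)
    rw [show -1 - U = (2 * k - 1 - U % (2 * k)) + (2 * k) * (-(U / (2 * k)) - 1) by linarith,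
      Int.add_mul_emod_self_left, Int.emod_eq_of_lt (by omega) (by omega)]
  ext
  simp only [fold, h]
  omega

lemma fold_add_period {k : ℕ} (hk : 0 < k) (U q : ℤ) : fold hk (U + 2 * k * q) = fold hk U := by
  ext
  simp only [fold, Int.add_mul_emod_self_left]

lemma lift_add_period {k : ℕ} (hk : 0 < k) (m : Bool) (U V q : ℤ) :
    lift hk m (U + 2 * k * q) V = lift hk m U V := by
  simp only [lift, fold_add_period, Int.add_mul_emod_self_left]

lemma lift_add_period_across {k : ℕ} (hk : 0 < k) (m : Bool) (U V q : ℤ) :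
    lift hk m U (V + 2 * k * q) = lift hk m U V := by
  simp only [lift, fold_add_period]

lemma lift_reflect {k : ℕ} (hk : 0 < k) (m : Bool) (U V : ℤ) :
    lift hk m U (-1 - V) = lift hk m U V := by
  simp only [lift, fold_reflect]

lemma gridMove_lift {k : ℕ} (hk : 0 < k) (m : Bool) (U V : ℤ) :
    gridMove (lift hk m U V).1 (lift hk m U V).2.1 (lift hk m U V).2.2 =
      lift hk m (U + 1) V := by
  have h1 := Int.emod_nonneg U (b := 2 * (k : ℤ)) (by omega)
  have h2 := Int.emod_lt_of_pos U (b := 2 * (k : ℤ)) (by omega)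
  have h3 : (U + 1) % (2 * k) = if U % (2 * k) + 1 = 2 * k then 0 else U % (2 * k) + 1 := by
    rw [← Int.emod_add_emod]
    split_ifs with h
    · rw [h, Int.emod_self]
    · exact Int.emod_eq_of_lt (by omega) (by omega)
  generalize hU : U % (2 * k) = r at h1 h2 h3
  by_cases hr : r < k
  · by_cases hr' : r + 1 < k
    · have h : (min r (2 * k - 1 - r)).toNat + 1 < k := by omega
      rw [if_neg (by omega)] at h3
      cases m <;> simp [lift, fold, h3, hU, hr, hr', h, gridMove] <;> omega
    · have h : ¬ (min r (2 * k - 1 - r)).toNat + 1 < k := by omega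
      rw [if_neg (by omega)] at h3
      cases m <;> simp [lift, fold, h3, hU, hr, hr', h, gridMove] <;> omega
  · by_cases hr' : r + 1 = 2 * k
    · have h : ¬ (0 < r ∧ r < 2 * k - 1) := by omega
      rw [if_pos hr'] at h3
      cases m <;> simp only [lift, fold, h3, hU, hr, gridMove] <;> simp [h] <;> omega
    · have h : 0 < r ∧ r < 2 * k - 1 := by omega
      have hr'' : ¬ r + 1 < k := by omega
      rw [if_neg hr'] at h3
      cases m <;> simp only [lift, fold, h3, hU, hr, hr'', gridMove] <;> simp [h] <;> omega

lemma exists_fold {k : ℕ} (hk : 0 < k) (x : Fin k) (b : Bool) :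
    ∃ U : ℤ, fold hk U = x ∧ (U % (2 * k) < k ↔ b = true) := by
  have hx := x.isLt
  cases b
  · have h : (2 * k - 1 - (x : ℕ) : ℤ) % (2 * k) = 2 * k - 1 - (x : ℕ) :=
      Int.emod_eq_of_lt (by omega) (by omega)
    refine ⟨2 * k - 1 - (x : ℕ), ?_, ?_⟩
    · ext; simp only [fold, h]; omega
    · rw [h]; simp; omega
  · have h : ((x : ℕ) : ℤ) % (2 * k) = (x : ℕ) := Int.emod_eq_of_lt (by omega) (by omega)
    refine ⟨(x : ℕ), ?_, ?_⟩
    · ext; simp only [fold, h]; omega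
    · rw [h]; simp

lemma exists_lift {k : ℕ} (hk : 0 < k) (s : Fin k × Fin k × Fin 4) :
    ∃ m U V, lift hk m U V = s := by
  obtain ⟨x, y, d⟩ := s
  obtain ⟨X, hX, hX'⟩ := exists_fold hk x (decide (d = 0))
  obtain ⟨Y, hY, hY'⟩ := exists_fold hk y (decide (d = 1))
  rcases (by omega : d = 0 ∨ d = 2 ∨ d = 1 ∨ d = 3) with h | h | h | h
  · exact ⟨true, X, Y, by subst h; simp_all [lift]⟩
  · exact ⟨true, X, Y, by subst h; simp_all [lift]⟩
  · exact ⟨false, Y, X, by subst h; simp_all [lift]⟩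
  · exact ⟨false, Y, X, by subst h; simp_all [lift]⟩

lemma exists_turn_lift {k : ℕ} (hk : 0 < k) (m : Bool) (U V : ℤ) :
    ∃ j : Fin 4, (j = 1 ∨ j = 3) ∧
      ((lift hk m U V).1, (lift hk m U V).2.1, (lift hk m U V).2.2 + j) = lift hk (!m) V U := by
  by_cases hU : U % (2 * k) < k <;> by_cases hV : V % (2 * k) < k
  · cases m
    · exact ⟨3, by simp, by simp [lift, hU, hV]⟩
    · exact ⟨1, by simp, by simp [lift, hU, hV]⟩
  · cases m
    · exact ⟨1, by simp, by simp [lift, hU, hV]⟩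
    · exact ⟨3, by simp, by simp [lift, hU, hV]⟩
  · cases m
    · exact ⟨1, by simp, by simp [lift, hU, hV]⟩
    · exact ⟨3, by simp, by simp [lift, hU, hV]⟩
  · cases m
    · exact ⟨3, by simp, by simp [lift, hU, hV]⟩
    · exact ⟨1, by simp, by simp [lift, hU, hV]⟩

/-! ### The transition matrix -/

lemma sum_gridChain_mul {k : ℕ} (g : Fin k × Fin k × Fin 4 → ℝ) (s : Fin k × Fin k × Fin 4) :
    ∑ s', gridChain k s s' * g s' =
      (1 - 1 / (k : ℝ)) * g (gridMove s.1 s.2.1 s.2.2)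
        + (1 / (2 * (k : ℝ))) * g (gridMove s.1 s.2.1 (s.2.2 + 1))
        + (1 / (2 * (k : ℝ))) * g (gridMove s.1 s.2.1 (s.2.2 + 3)) := by
  simp only [gridChain, add_mul, Finset.sum_add_distrib, mul_assoc, ← Finset.mul_sum, ite_mul,
    one_mul, zero_mul, Finset.sum_ite_eq, Finset.mem_univ, if_true]

lemma gridMove_turn_bijective {k : ℕ} (hk : 0 < k) (j : Fin 4) :
    Function.Bijective
      (fun s : Fin k × Fin k × Fin 4 => gridMove s.1 s.2.1 (s.2.2 + j)) := by
  refine Finite.surjective_iff_bijective.mp fun s => ?_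
  obtain ⟨m, U, V, rfl⟩ := exists_lift hk s
  refine ⟨((lift hk m (U - 1) V).1, (lift hk m (U - 1) V).2.1, (lift hk m (U - 1) V).2.2 - j), ?_⟩
  simp only [sub_add_cancel]
  rw [gridMove_lift, sub_add_cancel]

lemma sum_gridMove_turn {k : ℕ} (hk : 0 < k) (j : Fin 4) (s' : Fin k × Fin k × Fin 4) :
    ∑ s : Fin k × Fin k × Fin 4,
      (if gridMove s.1 s.2.1 (s.2.2 + j) = s' then (1 : ℝ) else 0) = 1 := by
  rw [(gridMove_turn_bijective hk j).sum_comp (fun s => if s = s' then (1 : ℝ) else 0)]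
  simp

lemma sum_gridChain_right {k : ℕ} (hk : 0 < k) (s : Fin k × Fin k × Fin 4) :
    ∑ s', gridChain k s s' = 1 := by
  have hk' : (k : ℝ) ≠ 0 := by positivity
  have h := sum_gridChain_mul (fun _ => 1) s
  simp only [mul_one] at h
  rw [h]
  field_simp
  ring

lemma sum_gridChain_left {k : ℕ} (hk : 0 < k) (s' : Fin k × Fin k × Fin 4) :
    ∑ s, gridChain k s s' = 1 := by
  have hk' : (k : ℝ) ≠ 0 := by positivity
  have h0 := sum_gridMove_turn hk 0 s'
  simp only [add_zero] at h0
  simp only [gridChain, Finset.sum_add_distrib, ← Finset.mul_sum, h0, sum_gridMove_turn hk]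
  field_simp
  ring

/-- The sign of a direction: `1` for horizontal and `-1` for vertical. -/
def axisSign (d : Fin 4) : ℝ := ![1, -1, 1, -1] d

lemma axisSign_gridMove {k : ℕ} (x y : Fin k) (d : Fin 4) :
    axisSign (gridMove x y d).2.2 = axisSign d := by
  fin_cases d <;> simp only [gridMove] <;> split_ifs <;> simp_all [axisSign]

lemma sum_gridChain_mul_axisSign {k : ℕ} (hk : 0 < k) (s : Fin k × Fin k × Fin 4) :
    ∑ s', gridChain k s s' * axisSign s'.2.2 = (1 - 2 / (k : ℝ)) * axisSign s.2.2 := by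
  have hk' : (k : ℝ) ≠ 0 := by positivity
  have h1 : ∀ d, axisSign (d + 1) = -axisSign d := by intro d; fin_cases d <;> simp [axisSign]
  have h3 : ∀ d, axisSign (d + 3) = -axisSign d := by intro d; fin_cases d <;> simp [axisSign]
  rw [sum_gridChain_mul (fun s' => axisSign s'.2.2)]
  simp only [axisSign_gridMove, h1, h3]
  field_simp
  ring

lemma one_sub_inv_nonneg {k : ℕ} (hk : 0 < k) : 0 ≤ 1 - 1 / (k : ℝ) := by
  rw [sub_nonneg, div_le_one (by positivity)]
  exact_mod_cast hk

lemma gridChain_nonneg {k : ℕ} (hk : 0 < k) (s s' : Fin k × Fin k × Fin 4) :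
    0 ≤ gridChain k s s' := by
  have h := one_sub_inv_nonneg hk
  unfold gridChain
  split_ifs <;> positivity

lemma gridChain_pow_nonneg {k : ℕ} (hk : 0 < k) (n : ℕ) (s s' : Fin k × Fin k × Fin 4) :
    0 ≤ (gridChain k ^ n) s s' := by
  induction n generalizing s' with
  | zero => rw [pow_zero, Matrix.one_apply]; split_ifs <;> norm_num
  | succ n ih =>
    rw [pow_succ, Matrix.mul_apply]
    exact Finset.sum_nonneg fun u _ => mul_nonneg (ih u) (gridChain_nonneg hk u s')

lemma sum_gridChain_pow_right {k : ℕ} (hk : 0 < k) (n : ℕ) (s : Fin k × Fin k × Fin 4) :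
    ∑ s', (gridChain k ^ n) s s' = 1 := by
  induction n with
  | zero => simp [Matrix.one_apply]
  | succ n ih =>
    simp only [pow_succ, Matrix.mul_apply]
    rw [Finset.sum_comm]
    simp only [← Finset.mul_sum, sum_gridChain_right hk, mul_one, ih]

lemma mul_le_gridChain_pow_add {k : ℕ} (hk : 0 < k) {m n : ℕ} {s u s' : Fin k × Fin k × Fin 4}
    {a b : ℝ} (hb : 0 ≤ b) (h₁ : a ≤ (gridChain k ^ m) s u) (h₂ : b ≤ (gridChain k ^ n) u s') :
    a * b ≤ (gridChain k ^ (m + n)) s s' := by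
  rw [pow_add, Matrix.mul_apply]
  calc a * b ≤ (gridChain k ^ m) s u * (gridChain k ^ n) u s' :=
        mul_le_mul h₁ h₂ hb (gridChain_pow_nonneg hk _ _ _)
    _ ≤ _ := Finset.single_le_sum
        (f := fun u => (gridChain k ^ m) s u * (gridChain k ^ n) u s')
        (fun u _ => mul_nonneg (gridChain_pow_nonneg hk _ _ _) (gridChain_pow_nonneg hk _ _ _))
        (Finset.mem_univ u)

/-! ### Lower bounds along paths -/

lemma straight_le {k : ℕ} (hk : 0 < k) (m : Bool) (U V : ℤ) (n : ℕ) :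
    (1 - 1 / (k : ℝ)) ^ n ≤ (gridChain k ^ n) (lift hk m U V) (lift hk m (U + n) V) := by
  have hp := one_sub_inv_nonneg hk
  induction n with
  | zero => simp
  | succ n ih =>
    rw [pow_succ]
    refine mul_le_gridChain_pow_add hk hp ih ?_
    rw [pow_one, gridChain, gridMove_lift,
      if_pos (by rw [Nat.cast_succ, ← add_assoc])]
    have : (0 : ℝ) ≤ 1 / (2 * (k : ℝ)) := by positivity
    split_ifs <;> linarith

lemma turn_le {k : ℕ} (hk : 0 < k) (m : Bool) (U V : ℤ) :
    1 / (2 * (k : ℝ)) ≤ gridChain k (lift hk m U V) (lift hk (!m) (V + 1) U) := by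
  have hp := one_sub_inv_nonneg hk
  have hq : (0 : ℝ) ≤ 1 / (2 * (k : ℝ)) := by positivity
  obtain ⟨j, hj, h⟩ := exists_turn_lift hk m U V
  have h' := gridMove_lift hk (!m) V U
  rw [← h] at h'
  unfold gridChain
  rcases hj with rfl | rfl <;> rw [if_pos h'] <;> split_ifs <;> linarith

lemma turn_straight_le {k : ℕ} (hk : 0 < k) (m : Bool) (U V : ℤ) (n : ℕ) :
    1 / (2 * (k : ℝ)) * (1 - 1 / (k : ℝ)) ^ n ≤
      (gridChain k ^ (1 + n)) (lift hk m U V) (lift hk (!m) (V + (n + 1 : ℕ)) U) := by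
  refine mul_le_gridChain_pow_add hk (pow_nonneg (one_sub_inv_nonneg hk) n)
    (by rw [pow_one]; exact turn_le hk m U V) ?_
  have := straight_le hk (!m) (V + 1) U n
  rwa [show V + 1 + (n : ℤ) = V + (n + 1 : ℕ) by push_cast; ring] at this

/-- A path with exactly two turns connects any two states moving along the same axis. -/
lemma two_turns_le {k : ℕ} (hk : 0 < k) (m : Bool) (U₀ V₀ U₁ V₁ : ℤ) :
    (1 - 1 / (k : ℝ)) ^ (6 * k - 2) * (1 / (2 * (k : ℝ))) ^ 2 ≤
      (gridChain k ^ (6 * k)) (lift hk m U₀ V₀) (lift hk m U₁ V₁) := by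
  have hp := one_sub_inv_nonneg hk
  wlog hpar : (-1 - U₀ - U₁ - (V₁ - V₀)) % 2 = 0 generalizing V₁
  · rw [← lift_reflect hk m U₁ V₁]
    exact this (-1 - V₁) (by omega)
  have hkz : (0 : ℤ) < k := by exact_mod_cast hk
  obtain ⟨b, q, hb, hbV⟩ : ∃ (b : ℕ) (q : ℤ), b < 2 * k ∧ (b : ℤ) + 1 = V₁ - V₀ + 2 * (k * q) := by
    have h1 := Int.emod_nonneg (V₁ - V₀ - 1) (b := 2 * (k : ℤ)) (by omega)
    have h2 := Int.emod_lt_of_pos (V₁ - V₀ - 1) (b := 2 * (k : ℤ)) (by omega)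
    have h3 := Int.emod_add_mul_ediv (V₁ - V₀ - 1) (2 * k)
    refine ⟨((V₁ - V₀ - 1) % (2 * k)).toNat, -((V₁ - V₀ - 1) / (2 * k)), by omega, ?_⟩
    rw [Int.toNat_of_nonneg h1]
    linarith
  obtain ⟨a, q', ha, haU⟩ : ∃ (a : ℕ) (q' : ℤ), a < k ∧
      2 * (a : ℤ) = -1 - U₀ - U₁ - (b + 1) + 2 * (k * q') := by
    obtain ⟨w, hw⟩ : ∃ w, -1 - U₀ - U₁ - ((b : ℤ) + 1) = 2 * w :=
      ⟨(-1 - U₀ - U₁ - (b + 1)) / 2, by omega⟩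
    have h1 := Int.emod_nonneg w (b := (k : ℤ)) (by omega)
    have h2 := Int.emod_lt_of_pos w (b := (k : ℤ)) (by omega)
    have h3 := Int.emod_add_mul_ediv w k
    refine ⟨(w % k).toNat, -(w / k), by omega, ?_⟩
    rw [Int.toNat_of_nonneg h1, hw]
    linarith
  obtain ⟨c, hc⟩ : ∃ c : ℕ, a + ((1 + b) + (1 + c)) = 6 * k := ⟨6 * k - a - b - 2, by omega⟩
  have hcz : (a : ℤ) + ((1 + b) + (1 + c)) = 6 * k := by exact_mod_cast hc
  have e₁ := straight_le hk m U₀ V₀ a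
  have e₂ := turn_straight_le hk m (U₀ + a) V₀ b
  have e₃ := turn_straight_le hk (!m) (V₀ + (b + 1 : ℕ)) (-1 - (U₀ + a)) c
  rw [lift_reflect, Bool.not_not, show -1 - (U₀ + a) + (c + 1 : ℕ) = U₁ + 2 * k * (3 - q') by
      push_cast; linarith, lift_add_period,
    show V₀ + (b + 1 : ℕ) = V₁ + 2 * k * q by push_cast; linarith,
    lift_add_period_across hk m U₁] at e₃
  rw [show V₀ + (b + 1 : ℕ) = V₁ + 2 * k * q by push_cast; linarith] at e₂
  have h := mul_le_gridChain_pow_add hk (by positivity) e₁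
    (mul_le_gridChain_pow_add hk (by positivity) e₂ e₃)
  rw [hc] at h
  refine le_of_eq_of_le ?_ h
  rw [show 6 * k - 2 = a + b + c by omega]
  ring

lemma two_turns_le_of_axis {k : ℕ} (hk : 0 < k) (s s' : Fin k × Fin k × Fin 4) :
    (1 - 1 / (k : ℝ)) ^ (6 * k - 2) * (1 / (2 * (k : ℝ))) ^ 2 *
      ((1 + axisSign s.2.2 * axisSign s'.2.2) / 2) ≤ (gridChain k ^ (6 * k)) s s' := by
  have hp := one_sub_inv_nonneg hk
  obtain ⟨m, U, V, rfl⟩ := exists_lift hk s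
  obtain ⟨m', U', V', rfl⟩ := exists_lift hk s'
  have hsign : ∀ m U V, axisSign (lift hk m U V).2.2 = if m then 1 else -1 := by
    intro m U V
    cases m <;> simp only [lift] <;> split_ifs <;> simp_all [axisSign]
  rw [hsign, hsign]
  by_cases h : m = m'
  · subst h
    refine le_of_eq_of_le ?_ (two_turns_le hk m U V U' V')
    cases m <;> norm_num
  · refine le_of_eq_of_le ?_ (gridChain_pow_nonneg hk _ _ _)
    cases m <;> cases m' <;> simp_all

/-! ### Contraction of balanced signed measures -/

/-- Total mass zero on the horizontal states and on the vertical states. -/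
def IsBalanced {k : ℕ} (f : Fin k × Fin k × Fin 4 → ℝ) : Prop :=
  ∑ s, f s = 0 ∧ ∑ s, f s * axisSign s.2.2 = 0

lemma IsBalanced.vecMul {k : ℕ} (hk : 0 < k) {f : Fin k × Fin k × Fin 4 → ℝ}
    (hf : IsBalanced f) : IsBalanced (f ᵥ* gridChain k) := by
  constructor
  · simp only [Matrix.vecMul, dotProduct]
    rw [Finset.sum_comm]
    simp only [← Finset.mul_sum, sum_gridChain_right hk, mul_one, hf.1]
  · simp only [Matrix.vecMul, dotProduct, Finset.sum_mul, mul_assoc]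
    rw [Finset.sum_comm]
    simp only [← Finset.mul_sum, sum_gridChain_mul_axisSign hk]
    simp only [mul_left_comm _ (1 - 2 / (k : ℝ)), ← Finset.mul_sum, hf.2, mul_zero]

lemma IsBalanced.vecMul_pow {k : ℕ} (hk : 0 < k) {f : Fin k × Fin k × Fin 4 → ℝ}
    (hf : IsBalanced f) (n : ℕ) : IsBalanced (f ᵥ* gridChain k ^ n) := by
  induction n with
  | zero => simpa
  | succ n ih => rw [pow_succ, ← Matrix.vecMul_vecMul]; exact ih.vecMul hk

lemma sum_abs_vecMul_pow_le {k : ℕ} (hk : 0 < k) (f : Fin k × Fin k × Fin 4 → ℝ) (n : ℕ) :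
    ∑ s, |(f ᵥ* gridChain k ^ n) s| ≤ ∑ s, |f s| := by
  calc ∑ s', |(f ᵥ* gridChain k ^ n) s'|
      ≤ ∑ s', ∑ s, |f s| * (gridChain k ^ n) s s' := by
        refine Finset.sum_le_sum fun s' _ => (Finset.abs_sum_le_sum_abs _ _).trans_eq ?_
        simp only [abs_mul, abs_of_nonneg (gridChain_pow_nonneg hk n _ s')]
    _ = ∑ s, |f s| := by
        rw [Finset.sum_comm]
        simp only [← Finset.mul_sum, sum_gridChain_pow_right hk, mul_one]

lemma sum_axisSign (k : ℕ) : ∑ s : Fin k × Fin k × Fin 4, axisSign s.2.2 = 0 := by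
  simp [Fintype.sum_prod_type, Fin.sum_univ_four, axisSign]

/-- The Doeblin constant of `6k` steps on each axis is at least `2^{-12}`. -/
lemma doeblin_const_ge {k : ℕ} (hk : 3 ≤ k) :
    (2 : ℝ) ^ (-12 : ℤ) ≤ (1 - 1 / (k : ℝ)) ^ (6 * k - 2) / 2 := by
  have hk' : (3 : ℝ) ≤ k := by exact_mod_cast hk
  have hpos : 0 < 1 - 1 / (k : ℝ) := by
    rw [sub_pos, div_lt_one (by linarith)]; linarith
  have h4 : (2 / 3 : ℝ) ^ 4 ≤ (1 - 1 / (k : ℝ)) ^ 4 := by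
    refine pow_le_pow_left₀ (by norm_num) ?_ 4
    have : 1 / (k : ℝ) ≤ 1 / 3 := one_div_le_one_div_of_le (by norm_num) hk'
    linarith
  have he : (Real.exp 1)⁻¹ ≤ (1 - 1 / (k : ℝ)) ^ (k - 1) := by
    rw [inv_le_comm₀ (Real.exp_pos 1) (pow_pos hpos _), ← inv_pow]
    have h1 : (1 - 1 / (k : ℝ))⁻¹ = 1 / ((k - 1 : ℕ) : ℝ) + 1 := by
      rw [Nat.cast_sub (by omega)]
      push_cast
      have : (k : ℝ) - 1 ≠ 0 := by linarith
      field_simp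
      ring
    have h2 : ((k - 1 : ℕ) : ℝ) ≠ 0 := by
      rw [Nat.cast_ne_zero]; omega
    rw [h1]
    calc (1 / ((k - 1 : ℕ) : ℝ) + 1) ^ (k - 1)
        ≤ Real.exp (1 / ((k - 1 : ℕ) : ℝ)) ^ (k - 1) :=
          pow_le_pow_left₀ (by positivity) (Real.add_one_le_exp _) _
      _ = Real.exp 1 := by rw [← Real.exp_nat_mul, mul_one_div_cancel h2]
  have he6 : (2.7183 : ℝ)⁻¹ ^ 6 ≤ ((1 - 1 / (k : ℝ)) ^ (k - 1)) ^ 6 := by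
    refine pow_le_pow_left₀ (by norm_num) (le_trans ?_ he) 6
    exact inv_anti₀ (Real.exp_pos 1) (by linarith [Real.exp_one_lt_d9])
  have hsplit : (1 - 1 / (k : ℝ)) ^ (6 * k - 2) =
      ((1 - 1 / (k : ℝ)) ^ (k - 1)) ^ 6 * (1 - 1 / (k : ℝ)) ^ 4 := by
    rw [← pow_mul, ← pow_add]
    congr 1
    omega
  have hmul := mul_le_mul he6 h4 (by norm_num) (by positivity)
  rw [hsplit]
  refine le_trans ?_ (div_le_div_of_nonneg_right hmul (by norm_num))
  norm_num

lemma IsBalanced.sum_abs_vecMul_pow_le {k : ℕ} (hk : 3 ≤ k) {f : Fin k × Fin k × Fin 4 → ℝ}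
    (hf : IsBalanced f) :
    ∑ s, |(f ᵥ* gridChain k ^ (6 * k)) s| ≤ (1 - (2 : ℝ) ^ (-12 : ℤ)) * ∑ s, |f s| := by
  have hk0 : 0 < k := by omega
  have hkr : (k : ℝ) ≠ 0 := by positivity
  set η : ℝ := (1 - 1 / (k : ℝ)) ^ (6 * k - 2) * (1 / (2 * (k : ℝ))) ^ 2 with hη
  set D : Fin k × Fin k × Fin 4 → Fin k × Fin k × Fin 4 → ℝ :=
    fun s s' => η * ((1 + axisSign s.2.2 * axisSign s'.2.2) / 2) with hD
  have hle : ∀ s s', D s s' ≤ (gridChain k ^ (6 * k)) s s' := two_turns_le_of_axis hk0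
  have hfD : ∀ s', ∑ s, f s * D s s' = 0 := by
    intro s'
    calc ∑ s, f s * D s s'
        = η / 2 * (∑ s, f s + axisSign s'.2.2 * ∑ s, f s * axisSign s.2.2) := by
          rw [Finset.mul_sum, ← Finset.sum_add_distrib, Finset.mul_sum]
          exact Finset.sum_congr rfl fun s _ => by simp only [hD]; ring
      _ = 0 := by rw [hf.1, hf.2]; ring
  have hDsum : ∀ s, ∑ s', D s s' = (1 - 1 / (k : ℝ)) ^ (6 * k - 2) / 2 := by
    intro s
    simp only [hD, ← Finset.mul_sum, ← Finset.sum_div, Finset.sum_add_distrib, sum_axisSign]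
    simp [hη]
    field_simp
    ring
  calc ∑ s', |(f ᵥ* gridChain k ^ (6 * k)) s'|
      ≤ ∑ s', ∑ s, |f s| * ((gridChain k ^ (6 * k)) s s' - D s s') := by
        refine Finset.sum_le_sum fun s' _ => ?_
        have : (f ᵥ* gridChain k ^ (6 * k)) s' =
            ∑ s, f s * ((gridChain k ^ (6 * k)) s s' - D s s') := by
          simp only [mul_sub, Finset.sum_sub_distrib, hfD, sub_zero]
          rfl
        rw [this]
        refine (Finset.abs_sum_le_sum_abs _ _).trans_eq ?_
        simp only [abs_mul, abs_of_nonneg (sub_nonneg.mpr (hle _ s'))]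
    _ = (1 - (1 - 1 / (k : ℝ)) ^ (6 * k - 2) / 2) * ∑ s, |f s| := by
        rw [Finset.sum_comm]
        simp only [← Finset.mul_sum, Finset.sum_sub_distrib, sum_gridChain_pow_right hk0, hDsum]
        rw [← Finset.sum_mul, mul_comm]
    _ ≤ _ := mul_le_mul_of_nonneg_right (by linarith [doeblin_const_ge hk])
        (Finset.sum_nonneg fun s _ => abs_nonneg _)

lemma IsBalanced.sum_abs_vecMul_pow_mul_le {k : ℕ} (hk : 3 ≤ k)
    {f : Fin k × Fin k × Fin 4 → ℝ} (hf : IsBalanced f) (n : ℕ) :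
    ∑ s, |(f ᵥ* gridChain k ^ (6 * k * n)) s| ≤
      (1 - (2 : ℝ) ^ (-12 : ℤ)) ^ n * ∑ s, |f s| := by
  induction n with
  | zero => simp
  | succ n ih =>
    rw [mul_add, mul_one, pow_add, ← Matrix.vecMul_vecMul, pow_succ',
      mul_assoc (1 - (2 : ℝ) ^ (-12 : ℤ))]
    exact ((hf.vecMul_pow (by omega) _).sum_abs_vecMul_pow_le hk).trans
      (mul_le_mul_of_nonneg_left ih
        (by norm_num : (0 : ℝ) ≤ 1 - (2 : ℝ) ^ (-12 : ℤ)))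

/-- After `6k(log(2/ε)/log(1/c) + 1)` steps, more than `log(2/ε)/log(1/c)` full blocks of `6k`
steps have elapsed. -/
lemma two_mul_pow_floor_le {c ε K : ℝ} (hc0 : 0 < c) (hc1 : c < 1) (hε : 0 < ε) {N t : ℕ}
    (hK : K = N) (hN : 0 < N) (ht : K * (Real.log (2 / ε) / Real.log (1 / c) + 1) ≤ t) :
    2 * c ^ (t / N) ≤ ε := by
  have hlog : 0 < Real.log (1 / c) := Real.log_pos (one_lt_one_div hc0 hc1)
  have hN' : (0 : ℝ) < N := by exact_mod_cast hN
  have hfl : (t : ℝ) < N * ((t / N : ℕ) + 1) := by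
    exact_mod_cast Nat.lt_mul_div_succ t hN
  have h1 : Real.log (2 / ε) / Real.log (1 / c) ≤ (t / N : ℕ) := by
    rw [hK] at ht
    have := lt_of_mul_lt_mul_left (ht.trans_lt hfl) hN'.le
    linarith
  rw [div_le_iff₀ hlog, ← Real.log_pow, Real.log_le_log_iff (by positivity) (by positivity),
    one_div, inv_pow, div_le_iff₀ hε, inv_mul_eq_div, le_div_iff₀ (by positivity)] at h1
  exact h1

end GridChain

/-- The LADA algorithm on the `k × k` grid (`k ≥ 3`): each node `v`
splits its initial value evenly among its four directional values, the vector of values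
is iterated as `y(t+1) = P̃ᵀ y(t)` with `P̃` the grid chain, and `x_v(t)` is the sum of
the four values of `v`. With `c = 1 − 2^{−12}`, for every `ε > 0` and every integer
`t ≥ 6k·(log(2/ε)/log(1/c) + 1)` the estimates satisfy
`∑_v |x_v(t) − x_ave| ≤ ε·∑_v x_v(0)`; hence the ε-averaging time is
`O(k·log(ε⁻¹))`. -/
theorem stmt8 (k : ℕ) (hk : 3 ≤ k)
    (x0 : Fin k × Fin k → ℝ) (hx0 : ∀ v, 0 ≤ x0 v)
    (xave : ℝ) (hxave : xave = ((k : ℝ) ^ 2)⁻¹ * ∑ v, x0 v)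
    (y : ℕ → Fin k × Fin k × Fin 4 → ℝ)
    (hy0 : ∀ (v : Fin k × Fin k) (l : Fin 4), y 0 (v.1, v.2, l) = x0 v / 4)
    (hyrec : ∀ t s', y (t + 1) s' = ∑ s, gridChain k s s' * y t s)
    (x : ℕ → Fin k × Fin k → ℝ)
    (hx : ∀ t v, x t v = ∑ l : Fin 4, y t (v.1, v.2, l))
    (c : ℝ) (hc : c = 1 - (2 : ℝ) ^ (-12 : ℤ))
    (ε : ℝ) (hε : 0 < ε) (t : ℕ)
    (ht : 6 * (k : ℝ) * (Real.log (2 / ε) / Real.log (1 / c) + 1) ≤ t) :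
    ∑ v, |x t v - xave| ≤ ε * ∑ v, x0 v := by
  have hk0 : 0 < k := by omega
  have hkr : (k : ℝ) ≠ 0 := by positivity
  set P := gridChain k with hP
  set f : ℕ → Fin k × Fin k × Fin 4 → ℝ := fun t s => y t s - xave / 4 with hf
  have hS : 0 ≤ ∑ v, x0 v := Finset.sum_nonneg fun v _ => hx0 v
  have hxave0 : 0 ≤ xave := by rw [hxave]; positivity
  have hkx : (k : ℝ) ^ 2 * xave = ∑ v, x0 v := by rw [hxave]; field_simp
  have hfrec : ∀ t, f (t + 1) = Matrix.vecMul (f t) P := by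
    intro t
    ext s'
    simp only [hf, Matrix.vecMul, dotProduct, sub_mul, Finset.sum_sub_distrib, ← Finset.mul_sum,
      hyrec, hP, GridChain.sum_gridChain_left hk0, mul_one]
    simp only [mul_comm]
  have hfpow : ∀ t, f t = Matrix.vecMul (f 0) (P ^ t) := by
    intro t
    induction t with
    | zero => simp
    | succ t ih => rw [hfrec, ih, Matrix.vecMul_vecMul, pow_succ]
  have hf0 : ∀ a b l, f 0 (a, b, l) = (x0 (a, b) - xave) / 4 := by
    intro a b l
    simp only [hf, hy0 (a, b) l, sub_div]
  have hsum0 : ∑ v, (x0 v - xave) = 0 := by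
    simp only [Finset.sum_sub_distrib, ← hkx, Finset.sum_const, Finset.card_univ,
      Fintype.card_prod, Fintype.card_fin, nsmul_eq_mul]
    push_cast
    ring
  have hbal : GridChain.IsBalanced (f 0) := by
    constructor
    · simp only [Fintype.sum_prod_type, hf0, Fin.sum_univ_four]
      rw [← hsum0, Fintype.sum_prod_type]
      exact Finset.sum_congr rfl fun a _ => Finset.sum_congr rfl fun b _ => by ring
    · simp [Fintype.sum_prod_type, hf0, Fin.sum_univ_four, GridChain.axisSign]
  have hf0norm : ∑ s, |f 0 s| ≤ 2 * ∑ v, x0 v := by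
    calc ∑ s, |f 0 s| = ∑ v, |x0 v - xave| := by
          simp only [Fintype.sum_prod_type, hf0, Fin.sum_univ_four, abs_div]
          refine Finset.sum_congr rfl fun a _ => Finset.sum_congr rfl fun b _ => ?_
          rw [abs_of_pos (by norm_num : (0 : ℝ) < 4)]
          ring
      _ ≤ ∑ v, (x0 v + xave) := Finset.sum_le_sum fun v _ => by
          rw [abs_le]; constructor <;> linarith [hx0 v]
      _ = ∑ v, (x0 v - xave) + 2 * ((k : ℝ) ^ 2 * xave) := by
          simp only [Finset.sum_add_distrib, Finset.sum_sub_distrib, Finset.sum_const,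
            Finset.card_univ, Fintype.card_prod, Fintype.card_fin, nsmul_eq_mul]
          push_cast
          ring
      _ = 2 * ∑ v, x0 v := by rw [hsum0, hkx, zero_add]
  have hxf : ∑ v, |x t v - xave| ≤ ∑ s, |f t s| := by
    simp only [Fintype.sum_prod_type]
    refine Finset.sum_le_sum fun a _ => Finset.sum_le_sum fun b _ => ?_
    have : x t (a, b) - xave = ∑ l : Fin 4, f t (a, b, l) := by
      simp only [hf, hx, Finset.sum_sub_distrib, Finset.sum_const, Finset.card_univ,
        Fintype.card_fin, nsmul_eq_mul]
      push_cast
      ring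
    rw [this]
    exact Finset.abs_sum_le_sum_abs _ _
  have hc0 : 0 < c := by rw [hc]; norm_num
  have hc1 : c < 1 := by rw [hc]; norm_num
  have hpow : 2 * c ^ (t / (6 * k)) ≤ ε :=
    GridChain.two_mul_pow_floor_le hc0 hc1 hε (by push_cast; ring) (by omega) ht
  have hblocks : ∑ s, |f t s| ≤ c ^ (t / (6 * k)) * ∑ s, |f 0 s| := by
    rw [hfpow t]
    nth_rewrite 1 [← Nat.div_add_mod t (6 * k)]
    rw [pow_add, ← Matrix.vecMul_vecMul, hc]
    exact (GridChain.sum_abs_vecMul_pow_le hk0 _ _).trans (hbal.sum_abs_vecMul_pow_mul_le hk _)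
  calc ∑ v, |x t v - xave| ≤ c ^ (t / (6 * k)) * (2 * ∑ v, x0 v) :=
        (hxf.trans hblocks).trans (mul_le_mul_of_nonneg_left hf0norm (by positivity))
    _ = 2 * c ^ (t / (6 * k)) * ∑ v, x0 v := by ring
    _ ≤ ε * ∑ v, x0 v := mul_le_mul_of_nonneg_right hpow hS
end

section
/- Let k ≥ 1 be an integer and let a, b be integers with a ≡ b (mod 2). Then there exist integers T₁, T₂ with 1 ≤ T₁ < T₂ ≤ 6k such that T₂ − T₁ ≡ a (mod 2k) and T₁ + T₂ ≡ b (mod 2k). -/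
/-- For every integer `k ≥ 1` and integers `a, b` of the same parity,
there exist turning times `T₁, T₂` with `1 ≤ T₁ < T₂ ≤ 6k`, `T₂ − T₁ ≡ a (mod 2k)` and
`T₁ + T₂ ≡ b (mod 2k)` (the two-turn case in the grid-chain analysis). -/
theorem stmt10 (k : ℕ) (hk : 1 ≤ k) (a b : ℤ) (hab : a ≡ b [ZMOD 2]) :
    ∃ T₁ T₂ : ℤ, 1 ≤ T₁ ∧ T₁ < T₂ ∧ T₂ ≤ 6 * (k : ℤ) ∧
      T₂ - T₁ ≡ a [ZMOD (2 * (k : ℤ))] ∧ T₁ + T₂ ≡ b [ZMOD (2 * (k : ℤ))] := by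
  obtain ⟨c, hc⟩ := hab.dvd
  have hk' : (0 : ℤ) < k := by exact_mod_cast hk
  have h2k : (0 : ℤ) < 2 * k := by linarith
  have hT := Int.emod_add_mul_ediv (c - 1) k
  have hT₀ := Int.emod_nonneg (c - 1) hk'.ne'
  have hT₁ := Int.emod_lt_of_pos (c - 1) hk'
  have hd := Int.emod_add_mul_ediv (a - 1) (2 * k)
  have hd₀ := Int.emod_nonneg (a - 1) h2k.ne'
  have hd₁ := Int.emod_lt_of_pos (a - 1) h2k
  refine ⟨(c - 1) % k + 1, (c - 1) % k + 1 + ((a - 1) % (2 * k) + 1),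
    by linarith, by linarith, by linarith, ?_, ?_⟩
  · exact Int.modEq_iff_dvd.mpr ⟨(a - 1) / (2 * k), by linear_combination -hd⟩
  · exact Int.modEq_iff_dvd.mpr ⟨(c - 1) / k + (a - 1) / (2 * k), by
      linear_combination hc - 2 * hT - hd⟩
end

section
/- Let k ≥ 1 be an integer and let a, b be integers with a ≡ b (mod 2). Then there exist at least 2k triples of integers (T₁, T₂, T₃) with 1 ≤ T₁ < T₂ < T₃ ≤ 6k such that T₃ − T₂ + T₁ ≡ a (mod 2k) and T₃ + T₂ − T₁ ≡ b (mod 2k). -/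
/-- For every integer `k ≥ 1` and integers `a, b` of the same parity,
there are at least `2k` triples of turning times `(T₁, T₂, T₃)` with
`1 ≤ T₁ < T₂ < T₃ ≤ 6k`, `T₃ − T₂ + T₁ ≡ a (mod 2k)` and `T₃ + T₂ − T₁ ≡ b (mod 2k)`
(the three-turn case in the grid-chain analysis). -/
theorem stmt11 (k : ℕ) (hk : 1 ≤ k) (a b : ℤ) (hab : a ≡ b [ZMOD 2]) :
    ∃ S : Finset (ℤ × ℤ × ℤ), 2 * k ≤ S.card ∧
      ∀ T ∈ S, 1 ≤ T.1 ∧ T.1 < T.2.1 ∧ T.2.1 < T.2.2 ∧ T.2.2 ≤ 6 * (k : ℤ) ∧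
        T.2.2 - T.2.1 + T.1 ≡ a [ZMOD (2 * (k : ℤ))] ∧
        T.2.2 + T.2.1 - T.1 ≡ b [ZMOD (2 * (k : ℤ))] := by
  have hk' : (0 : ℤ) < k := by exact_mod_cast hk
  obtain ⟨s, hs⟩ : (2 : ℤ) ∣ a + b := by
    have := hab.dvd
    omega
  -- The last turning time lies in `(5k, 6k]`, and the gap `T₂ - T₁` in `[1, 2k]`.
  obtain ⟨t, ht₁, ht₂, q, hq⟩ : ∃ t : ℤ, 5 * k < t ∧ t ≤ 6 * k ∧ (k : ℤ) ∣ s - t := by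
    have h₀ := Int.emod_nonneg (s - 1) hk'.ne'
    have h₁ := Int.emod_lt_of_pos (s - 1) hk'
    refine ⟨5 * k + 1 + (s - 1) % k, by linarith, by linarith, (s - 1) / k - 5, ?_⟩
    linarith [Int.emod_add_mul_ediv (s - 1) k]
  obtain ⟨d, hd₁, hd₂, m, hm⟩ : ∃ d : ℤ, 1 ≤ d ∧ d ≤ 2 * k ∧ (2 * k : ℤ) ∣ t - a - d := by
    have h₀ := Int.emod_nonneg (t - a - 1) (b := 2 * k) (by positivity)
    have h₁ := Int.emod_lt_of_pos (t - a - 1) (b := 2 * k) (by positivity)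
    refine ⟨1 + (t - a - 1) % (2 * k), by linarith, by linarith, (t - a - 1) / (2 * k), ?_⟩
    linarith [Int.emod_add_mul_ediv (t - a - 1) (2 * k)]
  refine ⟨(Finset.Icc (1 : ℤ) (2 * k)).image fun x => (x, x + d, t), ?_, ?_⟩
  · rw [Finset.card_image_of_injective _ fun x y h => congrArg Prod.fst h, Int.card_Icc]
    omega
  · simp only [Finset.mem_image, Finset.mem_Icc]
    rintro _ ⟨x, ⟨hx₁, hx₂⟩, rfl⟩
    refine ⟨hx₁, by linarith, by linarith, ht₂, ?_, ?_⟩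
    · exact Int.modEq_iff_dvd.2 ⟨-m, by linarith⟩
    · exact Int.modEq_iff_dvd.2 ⟨q + m, by linarith⟩
end

section
/- Let P be a row-stochastic matrix on a finite state space V with a strictly positive stationary probability vector π, and suppose there are an integer τ ≥ 1 and a constant 0 < c < 1 such that the τ-step transition probabilities satisfy P^τ(u,v) ≥ (1−c)·π(v) for all u, v ∈ V. Then there exists a flow f in the underlying graph of P whose congestion satisfies R(f) ≤ τ/(1−c). In particular, the resistance R(P) = inf over flows f of R(f) satisfies (1−c)·R(P) ≤ τ, i.e., for the fill time T_fill(P,c) one has R(P) ≤ T_fill(P,c)/(1−c), that is, T_fill(P,c) ≥ (1−c)·R(P). -/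
open Finset

namespace List

theorem isChain_of_forall_mem_zip_tail {α : Type*} {R : α → α → Prop} :
    ∀ {l : List α}, (∀ x y, (x, y) ∈ l.zip l.tail → R x y) → l.IsChain R
  | [], _ => .nil
  | [_], _ => .singleton _
  | a :: b :: l, h => .cons_cons (h a b (by simp))
      (isChain_of_forall_mem_zip_tail fun x y hxy => h x y (by simp_all))

theorem IsChain.rel_of_mem_zip_tail {α : Type*} {R : α → α → Prop} :
    ∀ {l : List α}, l.IsChain R → ∀ {x y}, (x, y) ∈ l.zip l.tail → R x y
  | [], _, _, _, h => by simp at h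
  | [_], _, _, _, h => by simp at h
  | a :: b :: l, hl, x, y, h => by
      rw [isChain_cons_cons] at hl
      simp only [tail_cons, zip_cons_cons, mem_cons, Prod.mk.injEq] at h
      rcases h with ⟨rfl, rfl⟩ | h
      · exact hl.1
      · exact hl.2.rel_of_mem_zip_tail (by simpa using h)

theorem zip_tail_subset_append {α : Type*} (l₁ l₂ : List α) :
    l₂.zip l₂.tail ⊆ (l₁ ++ l₂).zip (l₁ ++ l₂).tail := by
  induction l₁ with
  | nil => simp
  | cons a l ih =>
    refine List.Subset.trans ih ?_
    cases h : l ++ l₂ <;> simp [h]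

/-- Every walk contains a simple path with the same endpoints. -/
theorem exists_nodup_zip_tail_subset {α : Type*} [DecidableEq α] (l : List α) :
    ∃ p : List α, p.Nodup ∧ p.head? = l.head? ∧ p.getLast? = l.getLast? ∧
      p.zip p.tail ⊆ l.zip l.tail := by
  induction l with
  | nil => exact ⟨[], by simp⟩
  | cons a l ih =>
    obtain ⟨p, hnd, hhead, hlast, hsub⟩ := ih
    have hsub' : l.zip l.tail ⊆ (a :: l).zip (a :: l).tail :=
      zip_tail_subset_append [a] l
    by_cases ha : a ∈ p
    · obtain ⟨s, t, rfl⟩ := append_of_mem ha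
      refine ⟨a :: t, hnd.of_append_right, rfl, ?_,
        Subset.trans (Subset.trans (zip_tail_subset_append s (a :: t)) hsub) hsub'⟩
      rw [getLast?_cons (l := l), ← hlast]
      simp [getLast?_append, getLast?_cons]
    · refine ⟨a :: p, nodup_cons.2 ⟨ha, hnd⟩, rfl, by simp [getLast?_cons, hlast], ?_⟩
      cases p with
      | nil => simp
      | cons b p =>
        cases l with
        | nil => simp at hhead
        | cons b' l =>
          obtain rfl : b = b' := by simpa using hhead
          simp only [tail_cons, zip_cons_cons] at hsub ⊢
          exact cons_subset_cons _ hsub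

end List

section WalkExpectation

variable {V M N : Type*} [Fintype V] [AddCommGroup M] [Module ℝ M] [AddCommGroup N] [Module ℝ N]

/-- The expectation of `g` at the trajectory of the first `t` steps of the Markov chain with
transition matrix `P` started at `u`. -/
def walkExp (P : Matrix V V ℝ) : ℕ → V → (List V → M) → M
  | 0, u, g => g [u]
  | t + 1, u, g => ∑ w, P u w • walkExp P t w (fun γ => g (u :: γ))

theorem map_walkExp (P : Matrix V V ℝ) (φ : M →ₗ[ℝ] N) (t : ℕ) (u : V) (g : List V → M) :
    φ (walkExp P t u g) = walkExp P t u (fun γ => φ (g γ)) := by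
  induction t generalizing u g with
  | zero => rfl
  | succ t ih => simp [walkExp, ih]

theorem walkExp_mul_left (P : Matrix V V ℝ) (a : ℝ) (t : ℕ) (u : V) (g : List V → ℝ) :
    walkExp P t u (fun γ => a * g γ) = a * walkExp P t u g :=
  (map_walkExp P (LinearMap.mulLeft ℝ a) t u g).symm

theorem walkExp_add (P : Matrix V V ℝ) (t : ℕ) (u : V) (g h : List V → M) :
    walkExp P t u (fun γ => g γ + h γ) = walkExp P t u g + walkExp P t u h := by
  induction t generalizing u g h with
  | zero => rfl
  | succ t ih => simp [walkExp, ih, Finset.sum_add_distrib]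

theorem walkExp_mem {P : Matrix V V ℝ} (hP : ∀ u v, 0 ≤ P u v) (S : Submodule ℝ M)
    {t : ℕ} {u : V} {g : List V → M}
    (hg : ∀ γ : List V, γ.head? = some u → γ.IsChain (fun a b => 0 < P a b) → g γ ∈ S) :
    walkExp P t u g ∈ S := by
  induction t generalizing u g with
  | zero => exact hg [u] rfl (.singleton u)
  | succ t ih =>
    refine S.sum_mem fun w _ => ?_
    rcases (hP u w).eq_or_lt with h | h
    · simp [← h]
    · refine S.smul_mem _ (ih fun γ hw hγ => hg _ rfl ?_)
      exact List.isChain_cons.2 ⟨fun y hy => by simp_all, hγ⟩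

theorem walkExp_congr {P : Matrix V V ℝ} {t : ℕ} {u : V} {g h : List V → M}
    (hgh : ∀ γ : List V, γ.head? = some u → g γ = h γ) :
    walkExp P t u g = walkExp P t u h := by
  induction t generalizing u g h with
  | zero => exact hgh [u] rfl
  | succ t ih =>
    exact Finset.sum_congr rfl fun w _ => congrArg _ (ih fun γ _ => hgh _ rfl)

theorem walkExp_mono {P : Matrix V V ℝ} (hP : ∀ u v, 0 ≤ P u v) {t : ℕ} {u : V}
    {g h : List V → ℝ} (hgh : ∀ γ : List V, γ.head? = some u → g γ ≤ h γ) :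
    walkExp P t u g ≤ walkExp P t u h := by
  induction t generalizing u g h with
  | zero => exact hgh [u] rfl
  | succ t ih =>
    exact Finset.sum_le_sum fun w _ =>
      mul_le_mul_of_nonneg_left (ih fun γ _ => hgh _ rfl) (hP u w)

theorem walkExp_const {P : Matrix V V ℝ} (hP : ∀ u, ∑ v, P u v = 1) (t : ℕ) (u : V) (x : M) :
    walkExp P t u (fun _ => x) = x := by
  induction t generalizing u with
  | zero => rfl
  | succ t ih => simp [walkExp, ih, ← Finset.sum_smul, hP]

variable [DecidableEq V]

theorem walkExp_getLast? (P : Matrix V V ℝ) (t : ℕ) (u v : V) :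
    walkExp P t u (fun γ => if γ.getLast? = some v then (1 : ℝ) else 0) = (P ^ t) u v := by
  induction t generalizing u with
  | zero => simp [walkExp, Matrix.one_apply]
  | succ t ih =>
    rw [pow_succ', Matrix.mul_apply]
    refine Finset.sum_congr rfl fun w _ => ?_
    rw [← ih w, smul_eq_mul]
    refine congrArg _ (walkExp_congr fun γ hγ => ?_)
    cases γ with
    | nil => simp at hγ
    | cons b l => simp [List.getLast?_cons]

/-- A stationary chain uses the edge `(a, b)` on average `t * (μ a * P a b)` times in `t` steps. -/
theorem sum_mul_walkExp_count_zip_tail {P : Matrix V V ℝ} {μ : V → ℝ}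
    (hrow : ∀ u, ∑ v, P u v = 1) (hstat : ∀ v, ∑ u, μ u * P u v = μ v) (t : ℕ) (a b : V) :
    ∑ u, μ u * walkExp P t u (fun γ => ((γ.zip γ.tail).count (a, b) : ℝ)) =
      t * (μ a * P a b) := by
  induction t with
  | zero => simp [walkExp]
  | succ t ih =>
    have step (u w : V) : walkExp P t w
        (fun γ => (((u :: γ).zip (u :: γ).tail).count (a, b) : ℝ)) =
        walkExp P t w (fun γ => ((γ.zip γ.tail).count (a, b) : ℝ)) +
          if u = a ∧ w = b then 1 else 0 := by
      rw [← walkExp_const hrow t w (if u = a ∧ w = b then (1 : ℝ) else 0), ← walkExp_add]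
      refine walkExp_congr fun γ hγ => ?_
      cases γ with
      | nil => simp at hγ
      | cons x l =>
        obtain rfl : x = w := by simpa using hγ
        simp [List.count_cons]
    simp only [walkExp, step, smul_eq_mul, mul_add, Finset.sum_add_distrib, Finset.mul_sum]
    rw [Finset.sum_comm]
    simp only [← mul_assoc, ← Finset.sum_mul, hstat, ih]
    simp only [ite_and, mul_ite, mul_one, mul_zero]
    simp only [Finset.sum_ite_irrel, Finset.sum_const_zero, Finset.sum_ite_eq', Finset.mem_univ,
      if_true, Nat.cast_add, Nat.cast_one]
    ring

end WalkExpectation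

theorem Finsupp.sum_support_filter_eq_linearCombination {α : Type*} (f : α →₀ ℝ) (p : α → Prop)
    [DecidablePred p] :
    ∑ a ∈ f.support.filter p, f a =
      Finsupp.linearCombination ℝ (fun a => if p a then (1 : ℝ) else 0) f := by
  simp [Finsupp.linearCombination_apply, Finsupp.sum, Finset.sum_filter]

/-- Let `P` be a row-stochastic matrix on a finite state space `V`
with a strictly positive stationary probability vector `pi`, and suppose for some
integer `τ ≥ 1` and constant `0 < c < 1` the `τ`-step transition probabilities satisfy
`(P^τ)(u,v) ≥ (1−c)·pi v` for all `u, v`. Then there exists a flow `f` in the underlying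
graph of `P` (a nonnegative, finitely supported function on simple directed paths —
encoded as nodup lists of at least two vertices whose consecutive pairs are edges —
routing `pi u · pi v` between every ordered pair `u ≠ v`) whose congestion satisfies
`R(f) ≤ τ/(1−c)`: the flow through each edge `e = (u,v)` is at most
`(τ/(1−c))·Q(e)` with `Q(e) = pi u · P u v`. In particular the resistance satisfies
`R(P) ≤ T_fill(P,c)/(1−c)`. -/
theorem stmt12 {V : Type*} [Fintype V] [DecidableEq V]
    (P : Matrix V V ℝ) (pi : V → ℝ)
    (hPnn : ∀ u v, 0 ≤ P u v) (hProw : ∀ u, ∑ v, P u v = 1)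
    (hpipos : ∀ v, 0 < pi v) (hpisum : ∑ v, pi v = 1)
    (hstat : ∀ v, ∑ u, pi u * P u v = pi v)
    (τ : ℕ) (hτ : 1 ≤ τ) (c : ℝ) (hc0 : 0 < c) (hc1 : c < 1)
    (hfill : ∀ u v, (1 - c) * pi v ≤ (P ^ τ) u v) :
    ∃ f : List V →₀ ℝ,
      (∀ γ, 0 ≤ f γ) ∧
      (∀ γ ∈ f.support, γ.Nodup ∧ γ.Chain' (fun u v => 0 < P u v) ∧ 2 ≤ γ.length) ∧
      (∀ u v : V, u ≠ v →
        ∑ γ ∈ f.support.filter (fun γ => γ.head? = some u ∧ γ.getLast? = some v), f γ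
          = pi u * pi v) ∧
      (∀ u v : V, 0 < P u v →
        ∑ γ ∈ f.support.filter (fun γ => (u, v) ∈ γ.zip γ.tail), f γ
          ≤ ((τ : ℝ) / (1 - c)) * (pi u * P u v)) := by
  have hc : 0 < 1 - c := sub_pos.2 hc1
  choose r hnodup hhead hlast hsub using List.exists_nodup_zip_tail_subset (α := V)
  have hpos (u v : V) : 0 < (P ^ τ) u v := (mul_pos hc (hpipos v)).trans_le (hfill u v)
  let k (s : V) (γ : List V) : ℝ :=
    γ.getLast?.elim 0 fun v => if v = s then 0 else pi v / (P ^ τ) s v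
  have hk0 (s : V) (γ : List V) : 0 ≤ k s γ := by
    cases h : γ.getLast? with
    | none => simp [k, h]
    | some v =>
      simp only [k, h, Option.elim_some]
      split_ifs
      · rfl
      · exact (div_pos (hpipos v) (hpos s v)).le
  have hk1 (s : V) (γ : List V) : k s γ ≤ 1 / (1 - c) := by
    cases h : γ.getLast? with
    | none => simpa [k, h] using hc.le
    | some v =>
      simp only [k, h, Option.elim_some]
      split_ifs
      · positivity
      · rw [div_le_div_iff₀ (hpos s v) hc]
        linarith [hfill s v]
  let f : List V →₀ ℝ :=
    ∑ s, pi s • walkExp P τ s fun γ => Finsupp.single (r γ) (k s γ)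
  have hf (φ : (List V →₀ ℝ) →ₗ[ℝ] ℝ) :
      φ f = ∑ s, pi s * walkExp P τ s fun γ => φ (Finsupp.single (r γ) (k s γ)) := by
    simp [f, map_walkExp]
  refine ⟨f, fun γ => ?_, fun γ hγ => ?_, fun u v huv => ?_, fun u v _ => ?_⟩
  · have h := hf (Finsupp.lapply γ)
    rw [Finsupp.lapply_apply] at h
    rw [h]
    refine Finset.sum_nonneg fun s _ => mul_nonneg (hpipos s).le ?_
    rw [← walkExp_const hProw τ s (0 : ℝ)]
    refine walkExp_mono hPnn fun δ _ => ?_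
    exact Finsupp.single_nonneg.2 (hk0 s δ) γ
  · let S : Set (List V) :=
      {γ | γ.Nodup ∧ γ.IsChain (fun u v => 0 < P u v) ∧ 2 ≤ γ.length}
    have hfS : f ∈ Finsupp.supported ℝ ℝ S := by
      refine Submodule.sum_mem _ fun s _ => Submodule.smul_mem _ _ <|
        walkExp_mem hPnn _ fun δ hδ hchain => ?_
      by_cases hk : k s δ = 0
      · simp [hk]
      refine Finsupp.single_mem_supported ℝ _ ⟨hnodup δ, ?_, ?_⟩
      · exact List.isChain_of_forall_mem_zip_tail fun x y hxy =>
          hchain.rel_of_mem_zip_tail (hsub δ hxy)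
      · have h1 := (hhead δ).trans hδ
        have h2 := hlast δ
        match hr : r δ with
        | [] => simp [hr] at h1
        | [x] =>
          obtain rfl : x = s := by simpa [hr] using h1
          rw [hr, List.getLast?_singleton] at h2
          simp [k, ← h2] at hk
        | x :: y :: l => simp
    exact hfS hγ
  · rw [Finsupp.sum_support_filter_eq_linearCombination, hf, Finset.sum_eq_single u]
    · rw [walkExp_congr (h := fun γ => pi v / (P ^ τ) u v *
        if γ.getLast? = some v then (1 : ℝ) else 0), walkExp_mul_left, walkExp_getLast?,
        div_mul_cancel₀ _ (hpos u v).ne']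
      intro γ hγ
      by_cases h : γ.getLast? = some v
      · simp [hhead, hlast, hγ, h, k, huv.symm]
      · simp [hlast, h]
    · intro s _ hs
      rw [walkExp_congr (h := fun _ => (0 : ℝ)), walkExp_const hProw, mul_zero]
      intro γ hγ
      simp [hhead, hγ, hs]
    · simp
  · rw [Finsupp.sum_support_filter_eq_linearCombination, hf]
    calc _ ≤ ∑ s, pi s * walkExp P τ s
            (fun γ => 1 / (1 - c) * ((γ.zip γ.tail).count (u, v) : ℝ)) := by
          refine Finset.sum_le_sum fun s _ =>
            mul_le_mul_of_nonneg_left (walkExp_mono hPnn fun γ _ => ?_) (hpipos s).le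
          rw [Finsupp.linearCombination_single, smul_eq_mul]
          refine mul_le_mul (hk1 s γ) ?_ (by split_ifs <;> simp) (by positivity)
          split_ifs with h
          · exact_mod_cast List.one_le_count_iff.2 (hsub γ h)
          · positivity
      _ = 1 / (1 - c) * ∑ s, pi s * walkExp P τ s
            (fun γ => ((γ.zip γ.tail).count (u, v) : ℝ)) := by
          rw [Finset.mul_sum]
          exact Finset.sum_congr rfl fun s _ => by rw [walkExp_mul_left]; ring
      _ = τ / (1 - c) * (pi u * P u v) := by
          rw [sum_mul_walkExp_count_zip_tail hProw hstat]
          ring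
end

section
/- Let P be a row-stochastic matrix on a finite state space V with a strictly positive stationary probability vector π, let f be any flow in the underlying graph of P, and let S ⊆ V with 0 < π(S) < 1 and Q(S, S̄) > 0, where S̄ = V \ S, π(S) = ∑_{u∈S} π(u), and Q(S,S̄) = ∑_{u ∈ S} ∑_{v ∈ S̄} π(u)·P(u,v). Then the congestion of f satisfies R(f) ≥ π(S)·π(S̄)/Q(S,S̄). Consequently the resistance is at least the reciprocal of the conductance: R(P) ≥ 1/Φ(P), where Φ(P) = min over S with 0 < π(S) < 1 of Q(S,S̄)/(π(S)π(S̄)). -/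
open Finset

/-- A list that starts in `S` and ends outside `S` has consecutive entries crossing out of `S`. -/
theorem List.exists_mem_zip_tail_of_head?_of_getLast? {V : Type*} (S : Set V) (l : List V)
    {a b : V} (ha : l.head? = some a) (hb : l.getLast? = some b) (haS : a ∈ S) (hbS : b ∉ S) :
    ∃ u ∈ S, ∃ v ∉ S, (u, v) ∈ l.zip l.tail := by
  induction l generalizing a with
  | nil => simp at ha
  | cons x t ih =>
    obtain rfl : x = a := by simpa using ha
    cases t with
    | nil =>
      obtain rfl : x = b := by simpa using hb
      exact absurd haS hbS
    | cons y t =>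
      by_cases hy : y ∈ S
      · obtain ⟨u, hu, v, hv, huv⟩ := ih (a := y) rfl (by simpa using hb) hy
        exact ⟨u, hu, v, hv, by
          simp only [List.tail_cons, List.zip_cons_cons, List.mem_cons] at huv ⊢
          exact Or.inr huv⟩
      · exact ⟨x, haS, y, hy, by simp⟩

/-- Consecutive entries of a chain are related. -/
theorem List.IsChain.rel_of_mem_zip_tail_s13 {V : Type*} {R : V → V → Prop} {l : List V}
    (hl : l.IsChain R) {u v : V} (h : (u, v) ∈ l.zip l.tail) : R u v := by
  induction l with
  | nil => simp at h
  | cons x t ih =>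
    cases t with
    | nil => simp at h
    | cons y t =>
      rw [List.isChain_cons_cons] at hl
      simp only [List.tail_cons, List.zip_cons_cons, List.mem_cons, Prod.mk.injEq] at h
      rcases h with ⟨rfl, rfl⟩ | h
      · exact hl.1
      · exact ih hl.2 h

/-- The total weight of the paths from `S` to its complement is at most the total weight carried
by the edges from `S` to its complement. -/
theorem sum_endpoints_le_sum_edges {V : Type*} [Fintype V] [DecidableEq V]
    (A : Finset (List V)) (f : List V → ℝ) (hf : ∀ γ, 0 ≤ f γ) (S : Finset V) :
    ∑ p ∈ S ×ˢ Sᶜ, ∑ γ ∈ A.filter (fun γ => γ.head? = some p.1 ∧ γ.getLast? = some p.2), f γ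
      ≤ ∑ p ∈ S ×ˢ Sᶜ, ∑ γ ∈ A.filter (fun γ => (p.1, p.2) ∈ γ.zip γ.tail), f γ := by
  simp only [Finset.sum_filter]
  rw [Finset.sum_comm, Finset.sum_comm (s := S ×ˢ Sᶜ)]
  refine Finset.sum_le_sum fun γ _ => ?_
  have hnn : ∀ p ∈ S ×ˢ Sᶜ, 0 ≤ if (p.1, p.2) ∈ γ.zip γ.tail then f γ else 0 := by
    intro p _
    split_ifs
    exacts [hf γ, le_rfl]
  by_cases h : ∃ p ∈ S ×ˢ Sᶜ, γ.head? = some p.1 ∧ γ.getLast? = some p.2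
  · obtain ⟨⟨a, b⟩, hp, ha, hb⟩ := h
    have hab := hp
    simp only [Finset.mem_product, Finset.mem_compl] at hab
    obtain ⟨u, hu, v, hv, huv⟩ :=
      List.exists_mem_zip_tail_of_head?_of_getLast? (S : Set V) γ ha hb hab.1 hab.2
    calc _ = f γ := by
          rw [Finset.sum_eq_single_of_mem (a, b) hp]
          · simp only [ha, hb, and_self, if_true]
          · rintro ⟨c, d⟩ _ hne
            refine if_neg fun hcd => hne ?_
            simp_all
      _ = if (u, v) ∈ γ.zip γ.tail then f γ else 0 := (if_pos huv).symm
      _ ≤ _ := Finset.single_le_sum hnn (a := (u, v))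
          (Finset.mem_product.2 ⟨hu, Finset.mem_compl.2 hv⟩)
  · push Not at h
    rw [Finset.sum_eq_zero fun p hp => if_neg fun hc => h p hp hc.1 hc.2]
    exact Finset.sum_nonneg hnn

/-- Let `P` be a row-stochastic matrix on a finite state space `V`
with a strictly positive stationary probability vector `pi`, let `f` be any flow in
the underlying graph of `P` (a nonnegative, finitely supported function on simple
directed paths — encoded as nodup lists of at least two vertices whose consecutive
pairs are edges — routing `pi u · pi v` between every ordered pair `u ≠ v`), and let
`S` be a cut with `0 < pi(S) < 1` and `Q(S,Sᶜ) > 0`. Then the congestion of `f` is at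
least `pi(S)·pi(Sᶜ)/Q(S,Sᶜ)`: some edge `(u,v)` carries flow at least this multiple
of its capacity `Q(u,v) = pi u · P u v`. Consequently `R(P) ≥ 1/Φ(P)`. -/
theorem stmt13 {V : Type*} [Fintype V] [DecidableEq V]
    (P : Matrix V V ℝ) (pi : V → ℝ)
    (hPnn : ∀ u v, 0 ≤ P u v) (hProw : ∀ u, ∑ v, P u v = 1)
    (hpipos : ∀ v, 0 < pi v) (hpisum : ∑ v, pi v = 1)
    (hstat : ∀ v, ∑ u, pi u * P u v = pi v)
    (f : List V →₀ ℝ)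
    (hfnn : ∀ γ, 0 ≤ f γ)
    (hfsupp : ∀ γ ∈ f.support, γ.Nodup ∧ γ.Chain' (fun u v => 0 < P u v) ∧ 2 ≤ γ.length)
    (hflow : ∀ u v : V, u ≠ v →
      ∑ γ ∈ f.support.filter (fun γ => γ.head? = some u ∧ γ.getLast? = some v), f γ
        = pi u * pi v)
    (S : Finset V)
    (hS0 : 0 < ∑ u ∈ S, pi u) (hS1 : ∑ u ∈ S, pi u < 1)
    (hQ : 0 < ∑ u ∈ S, ∑ v ∈ Sᶜ, pi u * P u v) :
    ∃ u v : V, 0 < P u v ∧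
      ((∑ u' ∈ S, pi u') * (∑ v' ∈ Sᶜ, pi v')) / (∑ u' ∈ S, ∑ v' ∈ Sᶜ, pi u' * P u' v')
        ≤ (∑ γ ∈ f.support.filter (fun γ => (u, v) ∈ γ.zip γ.tail), f γ)
            / (pi u * P u v) := by
  by_contra! hcon
  set c := ((∑ u' ∈ S, pi u') * (∑ v' ∈ Sᶜ, pi v')) /
    (∑ u' ∈ S, ∑ v' ∈ Sᶜ, pi u' * P u' v') with hc
  have hpos : ∀ u v, 0 < P u v →
      ∑ γ ∈ f.support.filter (fun γ => (u, v) ∈ γ.zip γ.tail), f γ < c * (pi u * P u v) :=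
    fun u v h => (div_lt_iff₀ (mul_pos (hpipos u) h)).1 (hcon u v h)
  have hle : ∀ p ∈ S ×ˢ Sᶜ,
      ∑ γ ∈ f.support.filter (fun γ => (p.1, p.2) ∈ γ.zip γ.tail), f γ
        ≤ c * (pi p.1 * P p.1 p.2) := by
    intro p _
    rcases (hPnn p.1 p.2).lt_or_eq with h | h
    · exact (hpos _ _ h).le
    · rw [Finset.sum_eq_zero, ← h, mul_zero, mul_zero]
      intro γ hγ
      rw [Finset.mem_filter] at hγ
      have := List.IsChain.rel_of_mem_zip_tail_s13 (hfsupp γ hγ.1).2.1 hγ.2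
      exact absurd h this.ne
  rw [← Finset.sum_product'] at hQ
  obtain ⟨p, hp, hpQ⟩ := Finset.exists_lt_of_sum_lt (s := S ×ˢ Sᶜ) (f := fun _ => (0 : ℝ))
    (by simpa using hQ)
  have hlt := Finset.sum_lt_sum hle
    ⟨p, hp, hpos _ _ (pos_of_mul_pos_right hpQ (hpipos p.1).le)⟩
  have hroute : (∑ u ∈ S, pi u) * (∑ v ∈ Sᶜ, pi v) = ∑ p ∈ S ×ˢ Sᶜ,
      ∑ γ ∈ f.support.filter (fun γ => γ.head? = some p.1 ∧ γ.getLast? = some p.2), f γ := by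
    rw [Finset.sum_mul_sum, ← Finset.sum_product']
    refine Finset.sum_congr rfl fun p hp => (hflow p.1 p.2 ?_).symm
    rw [Finset.mem_product, Finset.mem_compl] at hp
    exact fun h => hp.2 (h ▸ hp.1)
  have hcut := sum_endpoints_le_sum_edges f.support f hfnn S
  rw [← hroute] at hcut
  rw [← Finset.mul_sum, hc, ← Finset.sum_product', div_mul_cancel₀ _ hQ.ne'] at hlt
  exact absurd hcut hlt.not_ge
end

section
/- Let X₁,…,X_n be points in the unit square [0,1]² ⊆ ℝ², let r > 0, C > 0, a ∈ ℝ, and let P be an n×n row-stochastic matrix that is conformant with the geometric graph of radius r (P(i,j) = 0 whenever i ≠ j and the Euclidean distance between X_i and X_j exceeds r), with a stationary probability vector π satisfying π(i) ≤ C/n for all i. Let S = {i : the first coordinate of X_i is ≤ a}, and suppose π(S) ≥ 1/4, π(Sᶜ) ≥ 1/4, and the number of indices i whose first coordinate lies within distance r of a (i.e., |X_i¹ − a| ≤ r) is at most 2rn. Then the conductance of this cut satisfies Q(S,Sᶜ)/(π(S)·π(Sᶜ)) ≤ 32·C·r, where Q(S,Sᶜ) = ∑_{i ∈ S} ∑_{j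 ∉ S} π(i)·P(i,j). -/
open Finset

theorem abs_coord_sub_le_dist {ι : Type*} [Fintype ι] (x y : EuclideanSpace ℝ ι) (k : ι) :
    |x k - y k| ≤ dist x y := by
  simpa [dist_eq_norm] using PiLp.norm_apply_le (x - y) k

/-- Deterministic core of the conductance upper bound `Φ(P) = O(r)`
on geometric graphs: if `P` is row-stochastic, conformant with the geometric graph of
radius `r` on points `X₁,…,X_n` of the unit square, with stationary distribution
`pi(i) ≤ C/n`, and the half-plane cut `S = {i : X_i¹ ≤ a}` satisfies `pi(S) ≥ 1/4`,
`pi(Sᶜ) ≥ 1/4`, while at most `2rn` points have first coordinate within `r` of `a`,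
then `Q(S,Sᶜ)/(pi(S)·pi(Sᶜ)) ≤ 32·C·r`. -/
theorem stmt14 {n : ℕ} (X : Fin n → EuclideanSpace ℝ (Fin 2))
    (r C a : ℝ) (hr : 0 < r) (hC : 0 < C)
    (hsq : ∀ i, X i 0 ∈ Set.Icc (0 : ℝ) 1 ∧ X i 1 ∈ Set.Icc (0 : ℝ) 1)
    (P : Matrix (Fin n) (Fin n) ℝ) (pi : Fin n → ℝ)
    (hPnn : ∀ i j, 0 ≤ P i j) (hProw : ∀ i, ∑ j, P i j = 1)
    (hpinn : ∀ i, 0 ≤ pi i) (hpisum : ∑ i, pi i = 1)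
    (hstat : ∀ j, ∑ i, pi i * P i j = pi j)
    (hconf : ∀ i j, i ≠ j → r < dist (X i) (X j) → P i j = 0)
    (hpi : ∀ i, pi i ≤ C / n)
    (S : Finset (Fin n)) (hS : S = univ.filter fun i => X i 0 ≤ a)
    (hS14 : 1 / 4 ≤ ∑ i ∈ S, pi i) (hSc14 : 1 / 4 ≤ ∑ i ∈ Sᶜ, pi i)
    (hcount : ((univ.filter fun i => |X i 0 - a| ≤ r).card : ℝ) ≤ 2 * r * n) :
    (∑ i ∈ S, ∑ j ∈ Sᶜ, pi i * P i j) / ((∑ i ∈ S, pi i) * (∑ j ∈ Sᶜ, pi j))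
      ≤ 32 * C * r := by
  have hn : (0 : ℝ) < n := by
    rcases Nat.eq_zero_or_pos n with rfl | h
    · simp at hpisum
    · exact_mod_cast h
  have hrow : ∀ i ∈ S, ∑ j ∈ Sᶜ, pi i * P i j ≤ if |X i 0 - a| ≤ r then C / n else 0 := by
    intro i hi
    split_ifs with hia
    · calc ∑ j ∈ Sᶜ, pi i * P i j ≤ ∑ j, pi i * P i j :=
            sum_le_sum_of_subset_of_nonneg (subset_univ _)
              fun j _ _ => mul_nonneg (hpinn i) (hPnn i j)
        _ = pi i := by rw [← mul_sum, hProw, mul_one]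
        _ ≤ C / n := hpi i
    · refine (sum_eq_zero fun j hj => ?_).le
      have hj' : a < X j 0 := by simpa [hS] using hj
      have hi' : X i 0 ≤ a := by simpa [hS] using hi
      have hfar : r < a - X i 0 := by
        rw [abs_of_nonpos (by linarith)] at hia
        linarith
      rw [hconf i j (fun h => by subst h; linarith) ?_, mul_zero]
      linarith [neg_le_abs (X i 0 - X j 0), abs_coord_sub_le_dist (X i) (X j) 0]
  have hQ : ∑ i ∈ S, ∑ j ∈ Sᶜ, pi i * P i j ≤ 2 * C * r :=
    calc ∑ i ∈ S, ∑ j ∈ Sᶜ, pi i * P i j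
        ≤ ∑ i ∈ S, if |X i 0 - a| ≤ r then C / n else 0 := sum_le_sum hrow
      _ ≤ ∑ i, if |X i 0 - a| ≤ r then C / n else 0 :=
          sum_le_sum_of_subset_of_nonneg (subset_univ _) fun i _ _ => by positivity
      _ = (univ.filter fun i => |X i 0 - a| ≤ r).card * (C / n) := by
          rw [← sum_filter, sum_const, nsmul_eq_mul]
      _ ≤ 2 * r * n * (C / n) := by gcongr
      _ = 2 * C * r := by field_simp
  have hprod : (1 / 4 : ℝ) * (1 / 4) ≤ (∑ i ∈ S, pi i) * (∑ j ∈ Sᶜ, pi j) := by gcongr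
  rw [div_le_iff₀ (by linarith)]
  nlinarith [mul_le_mul_of_nonneg_left hprod (by positivity : 0 ≤ 32 * C * r)]
end
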